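/- arXiv:math/0703280 — 2 statements merged into one kernel-verified Lean document; each statement's English description precedes it below -/
import Mathlib

section
/- Let ω = 1 and let A, B : ℝ → ℂ be polynomial functions in t with complex coefficients, of degrees at most 3 and 2 respectively. Then z = 0 is not a center for the equation ż = z⁴ + A(t)z³ + B(t)z². -/
/-- `z` is a solution of `ż = F(t,z)` on `[0, ω]`. -/
def IsSolution (ω : ℝ) (F : ℝ → ℂ → ℂ) (z : ℝ → ℂ) : Prop :=
  ∀ t ∈ Set.Icc (0 : ℝ) ω, HasDerivAt z (F t (z t)) t

/-- `z = 0` is a center for `ż = F(t,z)` with period `ω`. -/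
def IsCenter (ω : ℝ) (F : ℝ → ℂ → ℂ) : Prop :=
  ∃ ε > (0 : ℝ), ∀ c : ℂ, ‖c‖ < ε →
    ∃ z : ℝ → ℂ, IsSolution ω F z ∧ z 0 = c ∧ z ω = c

open Polynomial in
def Cen (e : ℂ) (A B : ℂ[X]) : Prop :=
  ∃ ε > (0 : ℝ), ∀ c : ℂ, ‖c‖ < ε → ∃ z : ℝ → ℂ,
    (∀ s ∈ Set.Icc (-1 : ℝ) 1, HasDerivAt z
      (e * z s ^ 4 + A.eval (s : ℂ) * z s ^ 3 + B.eval (s : ℂ) * z s ^ 2) s) ∧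
    z (-1) = c ∧ z 1 = c

open Polynomial in
lemma Cen.scale {e : ℂ} {A B : ℂ[X]} (h : Cen e A B) (μ : ℂ) (hμ : μ ≠ 0) :
    Cen (μ ^ 3 * e) (C (μ ^ 2) * A) (C μ * B) := by
  obtain ⟨ε, hε, h⟩ := h
  have hn : 0 < ‖μ‖ := norm_pos_iff.mpr hμ
  refine ⟨ε / ‖μ‖, by positivity, fun c hc => ?_⟩
  obtain ⟨z, hz, h0, h1⟩ := h (μ * c) (by
    rw [norm_mul]; rw [lt_div_iff₀ hn] at hc; linarith [mul_comm ‖c‖ ‖μ‖])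
  refine ⟨fun s => μ⁻¹ * z s, fun s hs => ?_, ?_, ?_⟩
  · refine ((hz s hs).const_mul μ⁻¹).congr_deriv ?_
    simp only [eval_mul, eval_C]
    field_simp
  · simp only [h0]; field_simp
  · simp only [h1]; field_simp

open Polynomial in
lemma sum_telescope (Q D : ℕ → ℂ) (e A B z : ℂ)
    (h0 : Q 0 = 0) (h1 : Q 1 = 1) (d0 : D 0 = 0) (d1 : D 1 = 0) (d2 : D 2 = - B) (N : ℕ)
    (h : ∀ n, n + 3 ≤ N + 2 → D (n + 3) = -((n + 2) * Q (n + 2) * B + (n + 1) * Q (n + 1) * A + n * Q n * e)) :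
    ∑ n ∈ Finset.range (N + 3), (D n * z ^ n +
        Q n * (n * z ^ (n - 1) * (e * z ^ 4 + A * z ^ 3 + B * z ^ 2))) =
      z ^ (N + 3) * (((N + 2) * Q (N + 2) * B + (N + 1) * Q (N + 1) * A + N * Q N * e) +
        z * ((N + 2) * Q (N + 2) * A + (N + 1) * Q (N + 1) * e) + z ^ 2 * ((N + 2) * Q (N + 2) * e)) := by
  induction N with
  | zero =>
    simp [Finset.sum_range_succ, h0, h1, d0, d1, d2]
    ring
  | succ N ih =>
    rw [Finset.sum_range_succ, ih (fun n hn => h n (by omega)), h N (by omega)]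
    have : N + 3 - 1 = N + 2 := rfl
    rw [this]
    push_cast
    ring_nf

open Polynomial in
lemma Cen.bound {e : ℂ} {A B : ℂ[X]} (h : Cen e A B) :
    ∃ ε > (0 : ℝ), ∃ K > (0 : ℝ), ∀ c : ℂ, c ≠ 0 → ‖c‖ < ε → ∃ z : ℝ → ℂ,
    (∀ s ∈ Set.Icc (-1 : ℝ) 1, HasDerivAt z
      (e * z s ^ 4 + A.eval (s : ℂ) * z s ^ 3 + B.eval (s : ℂ) * z s ^ 2) s) ∧
    z (-1) = c ∧ z 1 = c ∧ ∀ s ∈ Set.Icc (-1 : ℝ) 1, ‖z s‖ ≤ K * ‖c‖ ∧ ‖z s‖ ≤ 1 := by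
  obtain ⟨ε, hε, h⟩ := h
  have hcomp : IsCompact (Set.Icc (-1 : ℝ) 1 ×ˢ Metric.closedBall (0 : ℂ) 1) :=
    isCompact_Icc.prod (isCompact_closedBall _ _)
  obtain ⟨M, hM⟩ := hcomp.exists_bound_of_continuousOn
    (f := fun p : ℝ × ℂ => e * p.2 ^ 3 + A.eval (p.1 : ℂ) * p.2 ^ 2 + B.eval (p.1 : ℂ) * p.2)
    (by
      have hA : Continuous fun p : ℝ × ℂ => A.eval (p.1 : ℂ) := A.continuous.comp (by fun_prop)
      have hB : Continuous fun p : ℝ × ℂ => B.eval (p.1 : ℂ) := B.continuous.comp (by fun_prop)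
      fun_prop)
  set K := Real.exp ((M + 1) * 2) with hK
  have hM0 : 0 ≤ M := (norm_nonneg _).trans (hM (0, 0) (by simp))
  have hKpos : 0 < K := Real.exp_pos _
  refine ⟨min ε (1 / K), by positivity, K, hKpos, fun c hc0 hc => ?_⟩
  obtain ⟨z, hz, h0, h1⟩ := h c (hc.trans_le (min_le_left _ _))
  have hcK : K * ‖c‖ ≤ 1 := by
    have := hc.trans_le (min_le_right _ _)
    rw [lt_div_iff₀ hKpos] at this
    linarith [mul_comm ‖c‖ K]
  have hcp : 0 < ‖c‖ := norm_pos_iff.mpr hc0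
  have hexp : ∀ s ∈ Set.Icc (-1 : ℝ) 1, ‖c‖ * Real.exp ((M + 1) * (s + 1)) ≤ K * ‖c‖ := by
    intro s hs
    rw [mul_comm, hK]
    gcongr
    linarith [hs.2]
  have key : ∀ ⦃s⦄, s ∈ Set.Icc (-1 : ℝ) 1 → ‖z s‖ ≤ ‖c‖ * Real.exp ((M + 1) * (s + 1)) := by
    apply image_norm_le_of_norm_deriv_right_lt_deriv_boundary
      (f' := fun s => (e * z s ^ 4 + A.eval (s : ℂ) * z s ^ 3 + B.eval (s : ℂ) * z s ^ 2))
      (B := fun s => ‖c‖ * Real.exp ((M + 1) * (s + 1)))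
      (B' := fun s => ‖c‖ * (Real.exp ((M + 1) * (s + 1)) * ((M + 1) * 1)))
    · exact fun s hs => (hz s hs).continuousAt.continuousWithinAt
    · exact fun s hs => (hz s (Set.Ico_subset_Icc_self hs)).hasDerivWithinAt
    · simp [h0]
    · intro s
      exact ((((hasDerivAt_id s).add_const 1).const_mul (M + 1)).exp).const_mul ‖c‖
    · intro s hs heq
      have hs' := Set.Ico_subset_Icc_self hs
      have hle : ‖z s‖ ≤ 1 := by rw [heq]; exact (hexp s hs').trans hcK
      have hb := hM (s, z s) ⟨hs', by simpa using hle⟩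
      have : e * z s ^ 4 + A.eval (s : ℂ) * z s ^ 3 + B.eval (s : ℂ) * z s ^ 2
        = (e * z s ^ 3 + A.eval (s : ℂ) * z s ^ 2 + B.eval (s : ℂ) * z s) * z s := by ring
      rw [this, norm_mul]
      have hp : 0 < ‖c‖ * Real.exp ((M + 1) * (s + 1)) := by positivity
      calc _ ≤ M * ‖z s‖ := by gcongr
        _ < (M + 1) * ‖z s‖ := by rw [heq]; nlinarith
        _ = _ := by rw [heq]; ring
  exact ⟨z, hz, h0, h1, fun s hs => ⟨(key hs).trans (hexp s hs), ((key hs).trans (hexp s hs)).trans hcK⟩⟩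

open Polynomial in
structure FocalSeq (e : ℂ) (A B : ℂ[X]) (N : ℕ) (Q : ℕ → ℂ[X]) : Prop where
  q0 : Q 0 = 0
  q1 : Q 1 = 1
  q2 : ∀ s, (derivative (Q 2)).eval s = - B.eval s
  step : ∀ n, n < N → ∀ s, (derivative (Q (n + 3))).eval s = -((n + 2) * (Q (n + 2)).eval s * B.eval s
     + (n + 1) * (Q (n + 1)).eval s * A.eval s + n * (Q n).eval s * e)
  ini : ∀ n, n ≤ N → (Q (n + 2)).eval (-1) = 0

open Polynomial in
lemma Cen.focal_step {e : ℂ} {A B : ℂ[X]} (h : Cen e A B) {N : ℕ} {Q : ℕ → ℂ[X]}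
    (hQ : FocalSeq e A B N Q) (hz : ∀ n, n < N → (Q (n + 2)).eval 1 = 0) :
    (Q (N + 2)).eval 1 = 0 := by
  obtain ⟨ε, hε, K, hK, h⟩ := h.bound
  have hcomp : IsCompact (Set.Icc (-1 : ℝ) 1 ×ˢ Metric.closedBall (0 : ℂ) 1) :=
    isCompact_Icc.prod (isCompact_closedBall _ _)
  obtain ⟨M, hM⟩ := hcomp.exists_bound_of_continuousOn
    (f := fun p : ℝ × ℂ =>
      (((N + 2) * (Q (N + 2)).eval (p.1 : ℂ) * B.eval (p.1 : ℂ)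
        + (N + 1) * (Q (N + 1)).eval (p.1 : ℂ) * A.eval (p.1 : ℂ) + N * (Q N).eval (p.1 : ℂ) * e) +
        p.2 * ((N + 2) * (Q (N + 2)).eval (p.1 : ℂ) * A.eval (p.1 : ℂ)
          + (N + 1) * (Q (N + 1)).eval (p.1 : ℂ) * e)
        + p.2 ^ 2 * ((N + 2) * (Q (N + 2)).eval (p.1 : ℂ) * e)))
    (by
      have hp : ∀ P : ℂ[X], Continuous fun p : ℝ × ℂ => P.eval (p.1 : ℂ) :=
        fun P => P.continuous.comp (by fun_prop)
      have := hp A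
      have := hp B
      have := hp (Q (N + 2))
      have := hp (Q (N + 1))
      have := hp (Q N)
      fun_prop)
  have hM0 : 0 ≤ M := (norm_nonneg _).trans (hM (0, 0) (by simp))
  have main : ∀ c : ℂ, c ≠ 0 → ‖c‖ < ε → ‖(Q (N + 2)).eval 1‖ ≤ (K ^ (N + 3) * M * 2) * ‖c‖ := by
    intro c hc0 hc
    obtain ⟨z, hz', h0, h1, hb⟩ := h c hc0 hc
    have hcp : 0 < ‖c‖ := norm_pos_iff.mpr hc0
    have hderiv : ∀ s ∈ Set.Icc (-1 : ℝ) 1, HasDerivWithinAt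
        (fun s : ℝ => ∑ n ∈ Finset.range (N + 3), (Q n).eval (s : ℂ) * z s ^ n)
        (∑ n ∈ Finset.range (N + 3), ((derivative (Q n)).eval (s : ℂ) * z s ^ n +
          (Q n).eval (s : ℂ) * (n * z s ^ (n - 1) *
            (e * z s ^ 4 + A.eval (s : ℂ) * z s ^ 3 + B.eval (s : ℂ) * z s ^ 2))))
        (Set.Icc (-1) 1) s := by
      intro s hs
      apply HasDerivAt.hasDerivWithinAt
      apply HasDerivAt.fun_sum
      intro n _
      exact (((Q n).hasDerivAt (s : ℂ)).comp_ofReal).mul ((hz' s hs).pow n)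
    have hle := norm_image_sub_le_of_norm_deriv_le_segment' (C := K ^ (N + 3) * M * ‖c‖ ^ (N + 3)) hderiv
      (by
        intro s hs
        have hs' := Set.Ico_subset_Icc_self hs
        rw [sum_telescope (fun n => (Q n).eval (s : ℂ)) (fun n => (derivative (Q n)).eval (s : ℂ)) e
          (A.eval (s : ℂ)) (B.eval (s : ℂ)) (z s) (by simp [hQ.q0]) (by simp [hQ.q1]) (by simp [hQ.q0])
          (by simp [hQ.q1]) (hQ.q2 _) N (fun n hn => hQ.step n (by omega) _)]
        rw [norm_mul, norm_pow]
        have h2 := hM (s, z s) ⟨hs', by simpa using (hb s hs').2⟩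
        calc _ ≤ (K * ‖c‖) ^ (N + 3) * M := by
              gcongr
              exact (hb s hs').1
          _ = _ := by rw [mul_pow]; ring) 1 (by simp)
    have e1 : ∑ n ∈ Finset.range (N + 3), (Q n).eval ((1 : ℝ) : ℂ) * z 1 ^ n
        = c + (Q (N + 2)).eval 1 * c ^ (N + 2) := by
      rw [Finset.sum_range_succ, Finset.sum_range_succ', Finset.sum_range_succ']
      rw [Finset.sum_eq_zero]
      · simp [hQ.q0, hQ.q1, h1]
      · intro n hn
        have := hz n (by simpa using hn)
        push_cast
        rw [this, zero_mul]
    have e2 : ∑ n ∈ Finset.range (N + 3), (Q n).eval ((-1 : ℝ) : ℂ) * z (-1) ^ n = c := by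
      rw [Finset.sum_range_succ', Finset.sum_range_succ']
      rw [Finset.sum_eq_zero]
      · simp [hQ.q0, hQ.q1, h0]
      · intro n hn
        have := hQ.ini n (by have := Finset.mem_range.mp hn; omega)
        push_cast
        rw [this, zero_mul]
    rw [e1, e2, add_sub_cancel_left, norm_mul, norm_pow] at hle
    have hpp : 0 < ‖c‖ ^ (N + 2) := by positivity
    refine le_of_mul_le_mul_right (hle.trans (le_of_eq ?_)) hpp
    ring
  by_contra hne
  have hnp : 0 < ‖(Q (N + 2)).eval 1‖ := norm_pos_iff.mpr hne
  set q := ‖(Q (N + 2)).eval 1‖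
  set L := K ^ (N + 3) * M * 2
  have hL : 0 ≤ L := by positivity
  set r := min (ε / 2) (q / (2 * (L + 1))) with hr
  have hrp : 0 < r := by positivity
  have hh := main (r : ℂ) (by exact_mod_cast hrp.ne') (by
    rw [Complex.norm_real, Real.norm_of_nonneg hrp.le]
    exact (min_le_left _ _).trans_lt (by linarith))
  rw [Complex.norm_real, Real.norm_of_nonneg hrp.le] at hh
  have h3 : r * (2 * (L + 1)) ≤ q := by
    rw [← le_div_iff₀ (by positivity)]; exact min_le_right _ _
  nlinarith

open Polynomial in
lemma Cen.focal {e : ℂ} {A B : ℂ[X]} (h : Cen e A B) {N : ℕ} {Q : ℕ → ℂ[X]}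
    (hQ : FocalSeq e A B N Q) : ∀ n, n ≤ N → (Q (n + 2)).eval 1 = 0 := by
  intro n
  induction n using Nat.strong_induction_on with
  | _ n ih =>
    intro hn
    exact h.focal_step (N := n) ⟨hQ.q0, hQ.q1, hQ.q2, fun m hm => hQ.step m (by omega),
      fun m hm => hQ.ini m (by omega)⟩ (fun m hm => ih m hm (by omega))

open Polynomial in
noncomputable def pl : List ℂ → ℂ[X]
  | [] => 0
  | a :: l => C a + X * pl l

def pv : List ℂ → ℂ → ℂ
  | [], _ => 0
  | a :: l, s => a + s * pv l s

def gv : ℂ → List ℂ → ℂ → ℂ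
  | _, [], _ => 0
  | k, a :: l, s => k * a + s * gv (k + 1) l s

def dv : List ℂ → ℂ → ℂ
  | [], _ => 0
  | _ :: l, s => gv 1 l s

open Polynomial in
lemma eval_pl (l : List ℂ) (s : ℂ) : (pl l).eval s = pv l s := by
  induction l with
  | nil => simp [pl, pv]
  | cons a l ih => simp [pl, pv, ih]

lemma gv_succ (l : List ℂ) (k s : ℂ) : gv (k + 1) l s = gv k l s + pv l s := by
  induction l generalizing k with
  | nil => simp [gv, pv]
  | cons a l ih => simp only [gv, pv, ih (k + 1)]; ring

open Polynomial in
lemma deriv_pl (l : List ℂ) (s : ℂ) : (derivative (pl l)).eval s = dv l s := by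
  induction l with
  | nil => simp [pl, dv]
  | cons a l ih =>
    have : (derivative (pl (a :: l))).eval s = pv l s + s * dv l s := by
      simp [pl, eval_pl, ih]
    rw [this]
    cases l with
    | nil => simp [dv, gv, pv]
    | cons b l => simp only [dv, gv, pv, gv_succ l 1 s]; ring

open Polynomial in
noncomputable def Bp (b0 b1 : ℂ) : ℂ[X] := pl [b1, -2 * b0, -3 * b1]

open Polynomial in
noncomputable def Ap (a0 a1 a2 : ℂ) : ℂ[X] := pl [a1, 2 * (a2 - a0), -3 * a1, -4 * a2]

noncomputable def pw (x : ℂ) (n : ℕ) : ℂ := x ^ n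

set_option linter.unusedSimpArgs false
set_option linter.unusedTactic false
set_option linter.unusedVariables false

set_option maxHeartbeats 4000000 in
noncomputable def qG2 (b0 b1 a0 a1 a2 e : ℂ) : List ℂ :=
    [(-b0 : ℂ), (-b1 : ℂ), (b0 : ℂ), (b1 : ℂ)]

set_option maxHeartbeats 4000000 in
noncomputable def qG3 (b0 b1 a0 a1 a2 e : ℂ) : List ℂ :=
    [(pw b0 2 - a0 : ℂ), (2*b0*b1 - a1 : ℂ), (-2*pw b0 2 + pw b1 2 + a0 - a2 : ℂ), (-4*b0*b1 + a1 : ℂ), (pw b0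
    2 - 2*pw b1 2 + a2 : ℂ), (2*(b0*b1) : ℂ), (pw b1 2 : ℂ)]

set_option maxHeartbeats 4000000 in
noncomputable def qG4 (b0 b1 a0 a1 a2 e : ℂ) : List ℂ :=
    [(1/210*(-210*pw b0 3 + 525*b0*a0 - 56*b0*a1 + 35*b0*a2 + 56*b1*a0 - 8*b1*a2 - 210*e) : ℂ), (-3*pw b0 2*b1
    + 2*b0*a1 + 3*b1*a0 - e : ℂ), (1/2*(6*pw b0 3 - 6*b0*pw b1 2 - 10*b0*a0 + 4*b0*a2 + 5*b1*a1) : ℂ),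
    (1/3*(27*pw b0 2*b1 - 14*b0*a1 - 3*pw b1 3 - 16*b1*a0 + 7*b1*a2) : ℂ), (1/2*(-6*pw b0 3 + 18*b0*pw b1 2 +
    5*b0*a0 - 9*b0*a2 - 10*b1*a1) : ℂ), (1/5*(-45*pw b0 2*b1 + 12*b0*a1 + 15*pw b1 3 + 13*b1*a0 - 24*b1*a2) :
    ℂ), (1/6*(6*pw b0 3 - 54*b0*pw b1 2 + 14*b0*a2 + 15*b1*a1) : ℂ), (1/7*(21*pw b0 2*b1 - 21*pw b1 3 +
    17*b1*a2) : ℂ), (3*(b0*pw b1 2) : ℂ), (pw b1 3 : ℂ)]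

set_option maxHeartbeats 4000000 in
noncomputable def qG5 (b0 b1 a0 a1 a2 e : ℂ) : List ℂ :=
    [(1/1260*(1260*pw b0 4 - 5460*pw b0 2*a0 + 960*pw b0 2*a1 - 630*pw b0 2*a2 - 960*b0*b1*a0 + 105*b0*b1*a1 +
    64*b0*b1*a2 + 3360*b0*e - 105*pw b1 2*a0 + 21*pw b1 2*a2 + 630*b1*e + 1890*pw a0 2) : ℂ), (1/105*(420*pw
    b0 3*b1 - 315*pw b0 2*a1 - 1050*b0*b1*a0 + 112*b0*b1*a1 - 70*b0*b1*a2 + 210*b0*e - 112*pw b1 2*a0 + 16*pw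
    b1 2*a2 + 420*b1*e + 315*a0*a1) : ℂ), (1/210*(-840*pw b0 4 + 1260*pw b0 2*pw b1 2 + 2730*pw b0 2*a0 -
    224*pw b0 2*a1 - 490*pw b0 2*a2 + 224*b0*b1*a0 - 1470*b0*b1*a1 - 32*b0*b1*a2 - 840*b0*e - 1260*pw b1 2*a0
    + 630*b1*e - 630*pw a0 2 + 630*a0*a2 + 315*pw a1 2) : ℂ), (1/105*(-1680*pw b0 3*b1 + 1085*pw b0 2*a1 +
    420*b0*pw b1 3 + 3010*b0*b1*a0 - 112*b0*b1*a1 - 630*b0*b1*a2 - 350*b0*e + 112*pw b1 2*a0 - 455*pw b1 2*a1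
    - 16*pw b1 2*a2 - 420*b1*e - 630*a0*a1 + 315*a1*a2) : ℂ), (1/6*(36*pw b0 4 - 144*pw b0 2*pw b1 2 - 78*pw
    b0 2*a0 + 60*pw b0 2*a2 + 139*b0*b1*a1 + 6*pw b1 4 + 95*pw b1 2*a0 - 23*pw b1 2*a2 - 21*b1*e + 9*pw a0 2 -
    36*a0*a2 - 18*pw a1 2 + 9*pw a2 2) : ℂ), (1/15*(360*pw b0 3*b1 - 175*pw b0 2*a1 - 240*b0*pw b1 3 -
    410*b0*b1*a0 + 326*b0*b1*a2 + 195*pw b1 2*a1 + 45*a0*a1 - 90*a1*a2) : ℂ), (1/30*(-120*pw b0 4 + 1080*pw b0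
    2*pw b1 2 + 130*pw b0 2*a0 - 330*pw b0 2*a2 - 738*b0*b1*a1 - 120*pw b1 4 - 432*pw b1 2*a0 + 356*pw b1 2*a2
    + 90*a0*a2 + 45*pw a1 2 - 90*pw a2 2) : ℂ), (1/105*(-1680*pw b0 3*b1 + 423*pw b0 2*a1 + 2520*b0*pw b1 3 +
    942*b0*b1*a0 - 2426*b0*b1*a2 - 1365*pw b1 2*a1 + 315*a1*a2) : ℂ), (1/420*(420*pw b0 4 - 10080*pw b0 2*pw
    b1 2 + 1610*pw b0 2*a2 + 3507*b0*b1*a1 + 2520*pw b1 4 + 1953*pw b1 2*a0 - 5109*pw b1 2*a2 + 630*pw a2 2) :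
    ℂ), (1/63*(252*pw b0 3*b1 - 1008*b0*pw b1 3 + 500*b0*b1*a2 + 273*pw b1 2*a1) : ℂ), (2/35*(105*pw b0 2*pw
    b1 2 - 70*pw b1 4 + 72*pw b1 2*a2) : ℂ), (4*(b0*pw b1 3) : ℂ), (pw b1 4 : ℂ)]

open Polynomial in
noncomputable def QG (b0 b1 a0 a1 a2 e : ℂ) : ℕ → ℂ[X]
  | 1 => 1
  | 2 => pl (qG2 b0 b1 a0 a1 a2 e)
  | 3 => pl (qG3 b0 b1 a0 a1 a2 e)
  | 4 => pl (qG4 b0 b1 a0 a1 a2 e)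
  | 5 => pl (qG5 b0 b1 a0 a1 a2 e)
  | _ => 0

set_option maxHeartbeats 4000000 in
lemma qG3_step (b0 b1 a0 a1 a2 e s : ℂ) : dv (qG3 b0 b1 a0 a1 a2 e) s =
    -(((0 : ℕ) + 2) * (pv (qG2 b0 b1 a0 a1 a2 e) s) * (Bp (b0) (b1)).eval s + ((0 : ℕ) + 1) * (1) * (Ap (a0) (a1) (a2)).eval s
      + (0 : ℕ) * (0) * (e)) := by
  simp only [qG2, qG3, Ap, Bp, eval_pl, dv, gv, pv, pw]
  push_cast
  ring

set_option maxHeartbeats 4000000 in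
lemma qG4_step (b0 b1 a0 a1 a2 e s : ℂ) : dv (qG4 b0 b1 a0 a1 a2 e) s =
    -(((1 : ℕ) + 2) * (pv (qG3 b0 b1 a0 a1 a2 e) s) * (Bp (b0) (b1)).eval s + ((1 : ℕ) + 1) * (pv (qG2 b0 b1 a0 a1 a2 e) s) * (Ap (a0) (a1) (a2)).eval s
      + (1 : ℕ) * (1) * (e)) := by
  simp only [qG2, qG3, qG4, Ap, Bp, eval_pl, dv, gv, pv, pw]
  push_cast
  ring

set_option maxHeartbeats 4000000 in
lemma qG5_step (b0 b1 a0 a1 a2 e s : ℂ) : dv (qG5 b0 b1 a0 a1 a2 e) s =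
    -(((2 : ℕ) + 2) * (pv (qG4 b0 b1 a0 a1 a2 e) s) * (Bp (b0) (b1)).eval s + ((2 : ℕ) + 1) * (pv (qG3 b0 b1 a0 a1 a2 e) s) * (Ap (a0) (a1) (a2)).eval s
      + (2 : ℕ) * (pv (qG2 b0 b1 a0 a1 a2 e) s) * (e)) := by
  simp only [qG2, qG3, qG4, qG5, Ap, Bp, eval_pl, dv, gv, pv, pw]
  push_cast
  ring

lemma qG2_ini (b0 b1 a0 a1 a2 e : ℂ) : pv (qG2 b0 b1 a0 a1 a2 e) (-1) = 0 := by
  simp only [qG2, pv, pw]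
  ring

lemma qG3_ini (b0 b1 a0 a1 a2 e : ℂ) : pv (qG3 b0 b1 a0 a1 a2 e) (-1) = 0 := by
  simp only [qG3, pv, pw]
  ring

lemma qG4_ini (b0 b1 a0 a1 a2 e : ℂ) : pv (qG4 b0 b1 a0 a1 a2 e) (-1) = 0 := by
  simp only [qG4, pv, pw]
  ring

lemma qG5_ini (b0 b1 a0 a1 a2 e : ℂ) : pv (qG5 b0 b1 a0 a1 a2 e) (-1) = 0 := by
  simp only [qG5, pv, pw]
  ring

open Polynomial in
lemma FG (b0 b1 a0 a1 a2 e : ℂ) : FocalSeq (e) (Ap (a0) (a1) (a2)) (Bp (b0) (b1)) 3 (QG b0 b1 a0 a1 a2 e) := by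
  refine ⟨rfl, rfl, ?_, ?_, ?_⟩
  · intro s
    simp only [QG, qG2, eval_pl, deriv_pl, dv, gv, pv, pw, Ap, Bp]
    ring
  · intro n hn s
    interval_cases n
    · have := qG3_step b0 b1 a0 a1 a2 e s
      simpa only [Nat.reduceAdd, QG, eval_pl, deriv_pl, eval_one, eval_zero] using this
    · have := qG4_step b0 b1 a0 a1 a2 e s
      simpa only [Nat.reduceAdd, QG, eval_pl, deriv_pl, eval_one, eval_zero] using this
    · have := qG5_step b0 b1 a0 a1 a2 e s
      simpa only [Nat.reduceAdd, QG, eval_pl, deriv_pl, eval_one, eval_zero] using this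
  · intro n hn
    interval_cases n
    · exact (eval_pl _ _).trans (qG2_ini b0 b1 a0 a1 a2 e)
    · exact (eval_pl _ _).trans (qG3_ini b0 b1 a0 a1 a2 e)
    · exact (eval_pl _ _).trans (qG4_ini b0 b1 a0 a1 a2 e)
    · exact (eval_pl _ _).trans (qG5_ini b0 b1 a0 a1 a2 e)

open Polynomial in
set_option maxHeartbeats 4000000 in
lemma LG (b0 b1 a0 a1 a2 e : ℂ) (h : Cen (e) (Ap (a0) (a1) (a2)) (Bp (b0) (b1))) :
    -28*b0*a1 + 28*b1*a0 - 4*b1*a2 - 105*e = 0 ∧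
    -24*b0^2*a1 + 24*b0*b1*a0 - 8*b0*b1*a2 - 105*b0*e = 0 := by
  have H := FG b0 b1 a0 a1 a2 e
  have h4 : pv (qG4 b0 b1 a0 a1 a2 e) 1 = 0 := (eval_pl _ _).symm.trans (h.focal H 2 (by norm_num))
  simp only [qG4, pv, pw] at h4
  have h5 : pv (qG5 b0 b1 a0 a1 a2 e) 1 = 0 := (eval_pl _ _).symm.trans (h.focal H 3 (by norm_num))
  simp only [qG5, pv, pw] at h5
  refine ⟨?_, ?_⟩
  · linear_combination (105/2) * h4
  · linear_combination (315/8) * h5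

set_option maxHeartbeats 4000000 in
noncomputable def qI2 (a0 a1 a2 : ℂ) : List ℂ :=
    [(0 : ℂ), (-1 : ℂ), (0 : ℂ), (1 : ℂ)]

set_option maxHeartbeats 4000000 in
noncomputable def qI3 (a0 a1 a2 : ℂ) : List ℂ :=
    [(1/7*(-7*a0 - a2) : ℂ), (-a1 : ℂ), (1/7*(7*a0 - 6*a2 + 7) : ℂ), (a1 : ℂ), (a2 - 2 : ℂ), (0 : ℂ), (1 : ℂ)]

set_option maxHeartbeats 4000000 in
noncomputable def qI4 (a0 a1 a2 : ℂ) : List ℂ :=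
    [(0 : ℂ), (1/105*(287*a0 + 45*a2) : ℂ), (5/2*(a1) : ℂ), (1/21*(-112*a0 + 33*a2 - 21) : ℂ), (5*(-a1) : ℂ),
    (1/35*(91*a0 - 155*a2 + 105) : ℂ), (5/2*(a1) : ℂ), (1/7*(17*a2 - 21) : ℂ), (0 : ℂ), (1 : ℂ)]

set_option maxHeartbeats 4000000 in
noncomputable def qI5 (a0 a1 a2 : ℂ) : List ℂ :=
    [(1/2940*(4410*pw a0 2 + 1260*a0*a2 + 147*a0 + 90*pw a2 2 + 14*a2) : ℂ), (3/7*(7*a0*a1 + a1*a2) : ℂ),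
    (1/490*(-1470*pw a0 2 + 1050*a0*a2 - 2548*a0 + 735*pw a1 2 + 180*pw a2 2 - 420*a2) : ℂ), (1/21*(-126*a0*a1
    + 45*a1*a2 - 91*a1) : ℂ), (1/490*(735*pw a0 2 - 2730*a0*a2 + 7301*a0 - 1470*pw a1 2 + 330*pw a2 2 - 770*a2
    + 490) : ℂ), (1/7*(21*a0*a1 - 39*a1*a2 + 91*a1) : ℂ), (1/210*(630*a0*a2 - 3024*a0 + 315*pw a1 2 - 540*pw
    a2 2 + 2060*a2 - 840) : ℂ), (3*a1*a2 - 13*a1 : ℂ), (1/20*(93*a0 + 30*pw a2 2 - 230*a2 + 120) : ℂ),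
    (13/3*(a1) : ℂ), (4/35*(36*a2 - 35) : ℂ), (0 : ℂ), (1 : ℂ)]

set_option maxHeartbeats 4000000 in
noncomputable def qI6 (a0 a1 a2 : ℂ) : List ℂ :=
    [(1/88288200*(-2242240*pw a0 2 + 2207205*a0*a1 - 1537536*a0*a2 - 2935296*a0 + 210210*a1*a2 - 133120*pw a2
    2 - 215040*a2) : ℂ), (1/2940*(-19698*pw a0 2 - 5964*a0*a2 - 735*a0 - 450*pw a2 2 - 70*a2) : ℂ),
    (1/210*(-2639*a0*a1 - 405*a1*a2) : ℂ), (1/8820*(172186*pw a0 2 - 55608*a0*a2 + 76293*a0 - 51450*pw a1 2 -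
    12690*pw a2 2 + 12810*a2) : ℂ), (1/84*(3115*a0*a1 - 474*a1*a2 + 539*a1) : ℂ), (1/7350*(-139895*pw a0 2 +
    223552*a0*a2 - 233583*a0 + 128625*pw a1 2 - 2610*pw a2 2 + 2730*a2 - 7350) : ℂ), (1/210*(-7679*a0*a1 +
    5980*a1*a2 - 5390*a1) : ℂ), (1/10290*(63651*pw a0 2 - 348628*a0*a2 + 468489*a0 - 180075*pw a1 2 +
    115350*pw a2 2 - 160510*a2 + 51450) : ℂ), (1/280*(3367*a0*a1 - 9050*a1*a2 + 10780*a1) : ℂ),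
    (1/8820*(103908*a0*a2 - 257985*a0 + 51450*pw a1 2 - 130910*pw a2 2 + 267750*a2 - 88200) : ℂ),
    (1/210*(2397*a1*a2 - 5390*a1) : ℂ), (1/308*(2177*a0 + 1718*pw a2 2 - 6942*a2 + 3080) : ℂ), (77/12*(a1) :
    ℂ), (1/91*(544*a2 - 455) : ℂ), (0 : ℂ), (1 : ℂ)]

set_option maxHeartbeats 4000000 in
noncomputable def qI7 (a0 a1 a2 : ℂ) : List ℂ :=
    [(1/44144100*(-110360250*pw a0 3 - 47297250*pw a0 2*a2 - 7602595*pw a0 2 - 1956864*a0*a1 - 6756750*a0*pw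
    a2 2 - 805805*a0*a2 + 756756*a0 - 143360*a1*a2 - 321750*pw a2 3 - 30030*pw a2 2 + 45045*a2) : ℂ),
    (1/7357350*(-55180125*pw a0 2*a1 + 1121120*pw a0 2 - 15765750*a0*a1*a2 - 2942940*a0*a1 + 768768*a0*a2 +
    1467648*a0 - 1126125*a1*pw a2 2 - 280280*a1*a2 + 66560*pw a2 2 + 107520*a2) : ℂ), (1/308700*(2315250*pw a0
    3 - 1323000*pw a0 2*a2 + 5832029*pw a0 2 - 2315250*a0*pw a1 2 - 519750*a0*pw a2 2 + 1749300*a0*a2 +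
    231525*a0 - 330750*pw a1 2*a2 - 40500*pw a2 3 + 135450*pw a2 2 + 22050*a2) : ℂ), (1/22072050*(496621125*pw
    a0 2*a1 - 3363360*pw a0 2 - 189189000*a0*a1*a2 + 735244510*a0*a1 - 2306304*a0*a2 - 4402944*a0 -
    55180125*pw a1 3 - 37162125*a1*pw a2 2 + 117507390*a1*a2 - 199680*pw a2 2 - 322560*a2) : ℂ),
    (1/61740*(-463050*pw a0 3 + 1190700*pw a0 2*a2 - 4384226*pw a0 2 + 1389150*a0*pw a1 2 - 94500*a0*pw a2 2 +
    565509*a0*a2 - 854070*a0 - 264600*pw a1 2*a2 + 874650*pw a1 2 - 39150*pw a2 3 + 205590*pw a2 2 -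
    141120*a2) : ℂ), (1/2450*(-55125*pw a0 2*a1 + 94500*a0*a1*a2 - 313208*a0*a1 + 18375*pw a1 3 - 3750*a1*pw
    a2 2 + 15330*a1*a2 - 21315*a1) : ℂ), (1/308700*(771750*pw a0 3 - 6615000*pw a0 2*a2 + 31478482*pw a0 2 -
    6945750*a0*pw a1 2 + 5008500*a0*pw a2 2 - 27715184*a0*a2 + 18171111*a0 + 5953500*pw a1 2*a2 - 17493000*pw
    a1 2 + 81000*pw a2 3 - 1411830*pw a2 2 + 789390*a2 + 308700) : ℂ), (1/1470*(11025*pw a0 2*a1 -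
    63000*a0*a1*a2 + 275044*a0*a1 - 11025*pw a1 3 + 23850*a1*pw a2 2 - 114060*a1*a2 + 63945*a1) : ℂ),
    (1/102900*(771750*pw a0 2*a2 - 6736275*pw a0 2 + 771750*a0*pw a1 2 - 2094750*a0*pw a2 2 + 16305653*a0*a2 -
    11344872*a0 - 2205000*pw a1 2*a2 + 8746500*pw a1 2 + 456750*pw a2 3 - 2433090*pw a2 2 + 1988070*a2 -
    617400) : ℂ), (1/630*(9450*a0*a1*a2 - 76972*a0*a1 + 1575*pw a1 3 - 12825*a1*pw a2 2 + 89780*a1*a2 -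
    54810*a1) : ℂ), (1/102900*(1624203*pw a0 2 + 771750*a0*pw a2 2 - 11559660*a0*a2 + 10845121*a0 + 771750*pw
    a1 2*a2 - 5831000*pw a1 2 - 661500*pw a2 3 + 6025770*pw a2 2 - 6115830*a2 + 1543500) : ℂ),
    (1/2310*(69202*a0*a1 + 17325*a1*pw a2 2 - 239502*a1*a2 + 200970*a1) : ℂ), (1/4620*(133287*a0*a2 -
    234430*a0 + 65450*pw a1 2 + 11550*pw a2 3 - 217870*pw a2 2 + 321840*a2 - 92400) : ℂ), (1/2730*(74306*a1*a2
    - 118755*a1) : ℂ), (1/28028*(274729*a0 + 365742*pw a2 2 - 1061342*a2 + 420420) : ℂ), (87/10*(a1) : ℂ),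
    (1/364*(2903*a2 - 2184) : ℂ), (0 : ℂ), (1 : ℂ)]

open Polynomial in
noncomputable def QI (a0 a1 a2 : ℂ) : ℕ → ℂ[X]
  | 1 => 1
  | 2 => pl (qI2 a0 a1 a2)
  | 3 => pl (qI3 a0 a1 a2)
  | 4 => pl (qI4 a0 a1 a2)
  | 5 => pl (qI5 a0 a1 a2)
  | 6 => pl (qI6 a0 a1 a2)
  | 7 => pl (qI7 a0 a1 a2)
  | _ => 0

set_option maxHeartbeats 4000000 in
lemma qI3_step (a0 a1 a2 s : ℂ) : dv (qI3 a0 a1 a2) s =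
    -(((0 : ℕ) + 2) * (pv (qI2 a0 a1 a2) s) * (Bp (0) (1)).eval s + ((0 : ℕ) + 1) * (1) * (Ap (1/7*(7*a0 + a2)) (a1) (a2)).eval s
      + (0 : ℕ) * (0) * (4/15*(a0))) := by
  simp only [qI2, qI3, Ap, Bp, eval_pl, dv, gv, pv, pw]
  push_cast
  ring

set_option maxHeartbeats 4000000 in
lemma qI4_step (a0 a1 a2 s : ℂ) : dv (qI4 a0 a1 a2) s =
    -(((1 : ℕ) + 2) * (pv (qI3 a0 a1 a2) s) * (Bp (0) (1)).eval s + ((1 : ℕ) + 1) * (pv (qI2 a0 a1 a2) s) * (Ap (1/7*(7*a0 + a2)) (a1) (a2)).eval s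
      + (1 : ℕ) * (1) * (4/15*(a0))) := by
  simp only [qI2, qI3, qI4, Ap, Bp, eval_pl, dv, gv, pv, pw]
  push_cast
  ring

set_option maxHeartbeats 4000000 in
lemma qI5_step (a0 a1 a2 s : ℂ) : dv (qI5 a0 a1 a2) s =
    -(((2 : ℕ) + 2) * (pv (qI4 a0 a1 a2) s) * (Bp (0) (1)).eval s + ((2 : ℕ) + 1) * (pv (qI3 a0 a1 a2) s) * (Ap (1/7*(7*a0 + a2)) (a1) (a2)).eval s
      + (2 : ℕ) * (pv (qI2 a0 a1 a2) s) * (4/15*(a0))) := by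
  simp only [qI2, qI3, qI4, qI5, Ap, Bp, eval_pl, dv, gv, pv, pw]
  push_cast
  ring

set_option maxHeartbeats 4000000 in
lemma qI6_step (a0 a1 a2 s : ℂ) : dv (qI6 a0 a1 a2) s =
    -(((3 : ℕ) + 2) * (pv (qI5 a0 a1 a2) s) * (Bp (0) (1)).eval s + ((3 : ℕ) + 1) * (pv (qI4 a0 a1 a2) s) * (Ap (1/7*(7*a0 + a2)) (a1) (a2)).eval s
      + (3 : ℕ) * (pv (qI3 a0 a1 a2) s) * (4/15*(a0))) := by
  simp only [qI3, qI4, qI5, qI6, Ap, Bp, eval_pl, dv, gv, pv, pw]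
  push_cast
  ring

set_option maxHeartbeats 4000000 in
lemma qI7_step (a0 a1 a2 s : ℂ) : dv (qI7 a0 a1 a2) s =
    -(((4 : ℕ) + 2) * (pv (qI6 a0 a1 a2) s) * (Bp (0) (1)).eval s + ((4 : ℕ) + 1) * (pv (qI5 a0 a1 a2) s) * (Ap (1/7*(7*a0 + a2)) (a1) (a2)).eval s
      + (4 : ℕ) * (pv (qI4 a0 a1 a2) s) * (4/15*(a0))) := by
  simp only [qI4, qI5, qI6, qI7, Ap, Bp, eval_pl, dv, gv, pv, pw]
  push_cast
  ring

lemma qI2_ini (a0 a1 a2 : ℂ) : pv (qI2 a0 a1 a2) (-1) = 0 := by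
  simp only [qI2, pv, pw]
  ring

lemma qI3_ini (a0 a1 a2 : ℂ) : pv (qI3 a0 a1 a2) (-1) = 0 := by
  simp only [qI3, pv, pw]
  ring

lemma qI4_ini (a0 a1 a2 : ℂ) : pv (qI4 a0 a1 a2) (-1) = 0 := by
  simp only [qI4, pv, pw]
  ring

lemma qI5_ini (a0 a1 a2 : ℂ) : pv (qI5 a0 a1 a2) (-1) = 0 := by
  simp only [qI5, pv, pw]
  ring

lemma qI6_ini (a0 a1 a2 : ℂ) : pv (qI6 a0 a1 a2) (-1) = 0 := by
  simp only [qI6, pv, pw]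
  ring

lemma qI7_ini (a0 a1 a2 : ℂ) : pv (qI7 a0 a1 a2) (-1) = 0 := by
  simp only [qI7, pv, pw]
  ring

open Polynomial in
lemma FI (a0 a1 a2 : ℂ) : FocalSeq (4/15*(a0)) (Ap (1/7*(7*a0 + a2)) (a1) (a2)) (Bp (0) (1)) 5 (QI a0 a1 a2) := by
  refine ⟨rfl, rfl, ?_, ?_, ?_⟩
  · intro s
    simp only [QI, qI2, eval_pl, deriv_pl, dv, gv, pv, pw, Ap, Bp]
    ring
  · intro n hn s
    interval_cases n
    · have := qI3_step a0 a1 a2 s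
      simpa only [Nat.reduceAdd, QI, eval_pl, deriv_pl, eval_one, eval_zero] using this
    · have := qI4_step a0 a1 a2 s
      simpa only [Nat.reduceAdd, QI, eval_pl, deriv_pl, eval_one, eval_zero] using this
    · have := qI5_step a0 a1 a2 s
      simpa only [Nat.reduceAdd, QI, eval_pl, deriv_pl, eval_one, eval_zero] using this
    · have := qI6_step a0 a1 a2 s
      simpa only [Nat.reduceAdd, QI, eval_pl, deriv_pl, eval_one, eval_zero] using this
    · have := qI7_step a0 a1 a2 s
      simpa only [Nat.reduceAdd, QI, eval_pl, deriv_pl, eval_one, eval_zero] using this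
  · intro n hn
    interval_cases n
    · exact (eval_pl _ _).trans (qI2_ini a0 a1 a2)
    · exact (eval_pl _ _).trans (qI3_ini a0 a1 a2)
    · exact (eval_pl _ _).trans (qI4_ini a0 a1 a2)
    · exact (eval_pl _ _).trans (qI5_ini a0 a1 a2)
    · exact (eval_pl _ _).trans (qI6_ini a0 a1 a2)
    · exact (eval_pl _ _).trans (qI7_ini a0 a1 a2)

open Polynomial in
set_option maxHeartbeats 4000000 in
lemma LI (a0 a1 a2 : ℂ) (h : Cen (4/15*(a0)) (Ap (1/7*(7*a0 + a2)) (a1) (a2)) (Bp (0) (1))) :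
    -35035*a0^2 - 24024*a0*a2 - 45864*a0 - 2080*a2^2 - 3360*a2 = 0 ∧
    -273*a0*a1 - 20*a1*a2 = 0 := by
  have H := FI a0 a1 a2
  have h6 : pv (qI6 a0 a1 a2) 1 = 0 := (eval_pl _ _).symm.trans (h.focal H 4 (by norm_num))
  simp only [qI6, pv, pw] at h6
  have h7 : pv (qI7 a0 a1 a2) 1 = 0 := (eval_pl _ _).symm.trans (h.focal H 5 (by norm_num))
  simp only [qI7, pv, pw] at h7
  refine ⟨?_, ?_⟩
  · linear_combination (11036025/16) * h6
  · linear_combination (1576575/512) * h7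

set_option maxHeartbeats 4000000 in
noncomputable def qJ2 (a0 a2 : ℂ) : List ℂ :=
    [(0 : ℂ), (-1 : ℂ), (0 : ℂ), (1 : ℂ)]

set_option maxHeartbeats 4000000 in
noncomputable def qJ3 (a0 a2 : ℂ) : List ℂ :=
    [(1/7*(-7*a0 - a2) : ℂ), (0 : ℂ), (1/7*(7*a0 - 6*a2 + 7) : ℂ), (0 : ℂ), (a2 - 2 : ℂ), (0 : ℂ), (1 : ℂ)]

set_option maxHeartbeats 4000000 in
noncomputable def qJ4 (a0 a2 : ℂ) : List ℂ :=
    [(0 : ℂ), (1/105*(287*a0 + 45*a2) : ℂ), (0 : ℂ), (1/21*(-112*a0 + 33*a2 - 21) : ℂ), (0 : ℂ), (1/35*(91*a0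
    - 155*a2 + 105) : ℂ), (0 : ℂ), (1/7*(17*a2 - 21) : ℂ), (0 : ℂ), (1 : ℂ)]

set_option maxHeartbeats 4000000 in
noncomputable def qJ5 (a0 a2 : ℂ) : List ℂ :=
    [(1/2940*(4410*pw a0 2 + 1260*a0*a2 + 147*a0 + 90*pw a2 2 + 14*a2) : ℂ), (0 : ℂ), (1/245*(-735*pw a0 2 +
    525*a0*a2 - 1274*a0 + 90*pw a2 2 - 210*a2) : ℂ), (0 : ℂ), (1/490*(735*pw a0 2 - 2730*a0*a2 + 7301*a0 +
    330*pw a2 2 - 770*a2 + 490) : ℂ), (0 : ℂ), (1/105*(315*a0*a2 - 1512*a0 - 270*pw a2 2 + 1030*a2 - 420) :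
    ℂ), (0 : ℂ), (1/20*(93*a0 + 30*pw a2 2 - 230*a2 + 120) : ℂ), (0 : ℂ), (4/35*(36*a2 - 35) : ℂ), (0 : ℂ), (1
    : ℂ)]

set_option maxHeartbeats 4000000 in
noncomputable def qJ6 (a0 a2 : ℂ) : List ℂ :=
    [(8/11036025*(-35035*pw a0 2 - 24024*a0*a2 - 45864*a0 - 2080*pw a2 2 - 3360*a2) : ℂ), (1/2940*(-19698*pw
    a0 2 - 5964*a0*a2 - 735*a0 - 450*pw a2 2 - 70*a2) : ℂ), (0 : ℂ), (1/8820*(172186*pw a0 2 - 55608*a0*a2 +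
    76293*a0 - 12690*pw a2 2 + 12810*a2) : ℂ), (0 : ℂ), (1/7350*(-139895*pw a0 2 + 223552*a0*a2 - 233583*a0 -
    2610*pw a2 2 + 2730*a2 - 7350) : ℂ), (0 : ℂ), (1/10290*(63651*pw a0 2 - 348628*a0*a2 + 468489*a0 +
    115350*pw a2 2 - 160510*a2 + 51450) : ℂ), (0 : ℂ), (1/8820*(103908*a0*a2 - 257985*a0 - 130910*pw a2 2 +
    267750*a2 - 88200) : ℂ), (0 : ℂ), (1/308*(2177*a0 + 1718*pw a2 2 - 6942*a2 + 3080) : ℂ), (0 : ℂ),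
    (1/91*(544*a2 - 455) : ℂ), (0 : ℂ), (1 : ℂ)]

set_option maxHeartbeats 4000000 in
noncomputable def qJ7 (a0 a2 : ℂ) : List ℂ :=
    [(1/308700*(-771750*pw a0 3 - 330750*pw a0 2*a2 - 53165*pw a0 2 - 47250*a0*pw a2 2 - 5635*a0*a2 + 5292*a0
    - 2250*pw a2 3 - 210*pw a2 2 + 315*a2) : ℂ), (16/3678675*(35035*pw a0 2 + 24024*a0*a2 + 45864*a0 + 2080*pw
    a2 2 + 3360*a2) : ℂ), (1/308700*(2315250*pw a0 3 - 1323000*pw a0 2*a2 + 5832029*pw a0 2 - 519750*a0*pw a2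
    2 + 1749300*a0*a2 + 231525*a0 - 40500*pw a2 3 + 135450*pw a2 2 + 22050*a2) : ℂ), (16/3678675*(-35035*pw a0
    2 - 24024*a0*a2 - 45864*a0 - 2080*pw a2 2 - 3360*a2) : ℂ), (1/61740*(-463050*pw a0 3 + 1190700*pw a0 2*a2
    - 4384226*pw a0 2 - 94500*a0*pw a2 2 + 565509*a0*a2 - 854070*a0 - 39150*pw a2 3 + 205590*pw a2 2 -
    141120*a2) : ℂ), (0 : ℂ), (1/308700*(771750*pw a0 3 - 6615000*pw a0 2*a2 + 31478482*pw a0 2 +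
    5008500*a0*pw a2 2 - 27715184*a0*a2 + 18171111*a0 + 81000*pw a2 3 - 1411830*pw a2 2 + 789390*a2 + 308700)
    : ℂ), (0 : ℂ), (1/102900*(771750*pw a0 2*a2 - 6736275*pw a0 2 - 2094750*a0*pw a2 2 + 16305653*a0*a2 -
    11344872*a0 + 456750*pw a2 3 - 2433090*pw a2 2 + 1988070*a2 - 617400) : ℂ), (0 : ℂ), (1/102900*(1624203*pw
    a0 2 + 771750*a0*pw a2 2 - 11559660*a0*a2 + 10845121*a0 - 661500*pw a2 3 + 6025770*pw a2 2 - 6115830*a2 +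
    1543500) : ℂ), (0 : ℂ), (1/4620*(133287*a0*a2 - 234430*a0 + 11550*pw a2 3 - 217870*pw a2 2 + 321840*a2 -
    92400) : ℂ), (0 : ℂ), (1/28028*(274729*a0 + 365742*pw a2 2 - 1061342*a2 + 420420) : ℂ), (0 : ℂ),
    (1/364*(2903*a2 - 2184) : ℂ), (0 : ℂ), (1 : ℂ)]

set_option maxHeartbeats 4000000 in
noncomputable def qJ8 (a0 a2 : ℂ) : List ℂ :=
    [(16/374286787875*(2138781645*pw a0 3 + 1953605745*pw a0 2*a2 + 2957623144*pw a0 2 + 253684200*a0*pw a2 2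
    + 119652120*a0*a2 - 187689600*a0 + 11628000*pw a2 3 + 319200*pw a2 2 - 9408000*a2) : ℂ),
    (1/44100*(683550*pw a0 3 + 305550*pw a0 2*a2 + 50225*pw a0 2 + 45450*a0*pw a2 2 + 5355*a0*a2 - 5292*a0 +
    2250*pw a2 3 + 210*pw a2 2 - 315*a2) : ℂ), (8/25750725*(-490490*pw a0 3 + 84084*pw a0 2*a2 - 2358811*pw a0
    2 + 259168*a0*pw a2 2 - 673848*a0*a2 - 2247336*a0 + 24960*pw a2 3 - 61600*pw a2 2 - 164640*a2) : ℂ),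
    (1/926100*(-55998180*pw a0 3 + 15192450*pw a0 2*a2 - 40726448*pw a0 2 + 8368920*a0*pw a2 2 -
    11305035*a0*a2 - 1509543*a0 + 722250*pw a2 3 - 876960*pw a2 2 - 147735*a2) : ℂ), (16/3678675*(-35035*pw a0
    2*a2 + 245245*pw a0 2 - 24024*a0*pw a2 2 + 122304*a0*a2 + 321048*a0 - 2080*pw a2 3 + 11200*pw a2 2 +
    23520*a2) : ℂ), (1/1543500*(136527720*pw a0 3 - 202145580*pw a0 2*a2 + 301830739*pw a0 2 - 8224650*a0*pw
    a2 2 - 6348195*a0*a2 + 34342875*a0 + 3954150*pw a2 3 - 9139200*pw a2 2 + 5402250*a2) : ℂ),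
    (8/525525*(-35035*pw a0 2 - 24024*a0*a2 - 45864*a0 - 2080*pw a2 2 - 3360*a2) : ℂ),
    (1/2160900*(-124529580*pw a0 3 + 487834788*pw a0 2*a2 - 792491896*pw a0 2 - 188524224*a0*pw a2 2 +
    415717029*a0*a2 - 218933127*a0 - 14209830*pw a2 3 + 41050800*pw a2 2 - 17168130*a2 - 2160900) : ℂ), (0 :
    ℂ), (1/6482700*(91282590*pw a0 3 - 1029660030*pw a0 2*a2 + 2261587993*pw a0 2 + 1220319114*a0*pw a2 2 -
    3167504109*a0*a2 + 1483738767*a0 - 107602470*pw a2 3 + 172029900*pw a2 2 - 113066520*a2 + 45378900) : ℂ),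
    (0 : ℂ), (1/1131900*(46030110*pw a0 2*a2 - 188949096*pw a0 2 - 163859080*a0*pw a2 2 + 603652413*a0*a2 -
    325957359*a0 + 57615450*pw a2 3 - 163927680*pw a2 2 + 107492280*a2 - 23769900) : ℂ), (0 : ℂ),
    (1/2102100*(67313799*pw a0 2 + 82010670*a0*pw a2 2 - 583127895*a0*a2 + 434512743*a0 - 91536850*pw a2 3 +
    407525360*pw a2 2 - 336113190*a2 + 73573500) : ℂ), (0 : ℂ), (1/2102100*(118729779*a0*a2 - 167355825*a0 +
    26117910*pw a2 3 - 236007760*pw a2 2 + 282999850*a2 - 73573500) : ℂ), (0 : ℂ), (1/68068*(872235*a0 +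
    1671690*pw a2 2 - 3929221*a2 + 1429428) : ℂ), (0 : ℂ), (1/988*(9957*a2 - 6916) : ℂ), (0 : ℂ), (1 : ℂ)]

set_option maxHeartbeats 4000000 in
noncomputable def qJ9 (a0 a2 : ℂ) : List ℂ :=
    [(1/2852388000*(12479197500*pw a0 4 + 7130970000*pw a0 3*a2 + 1327416860*pw a0 3 + 1528065000*pw a0 2*pw
    a2 2 + 212659216*pw a0 2*a2 - 180662559*pw a0 2 + 145530000*a0*pw a2 3 + 33268620*a0*pw a2 2 +
    9410940*a0*a2 + 10187100*a0 + 5197500*pw a2 4 + 1445400*pw a2 3 + 762300*pw a2 2 + 441000*a2) : ℂ),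
    (64/374286787875*(-4039920885*pw a0 3 - 3744256698*pw a0 2*a2 - 5604150776*pw a0 2 - 493259760*a0*pw a2 2
    - 216513360*a0*a2 + 375379200*a0 - 23256000*pw a2 3 - 638400*pw a2 2 + 18816000*a2) : ℂ),
    (1/308700*(-5402250*pw a0 4 + 2315250*pw a0 3*a2 - 17856923*pw a0 3 + 1653750*pw a0 2*pw a2 2 - 7774879*pw
    a0 2*a2 - 1307516*pw a0 2 + 267750*a0*pw a2 3 - 1202460*a0*pw a2 2 - 173607*a0*a2 + 148176*a0 + 13500*pw
    a2 4 - 61740*pw a2 3 - 7770*pw a2 2 + 8820*a2) : ℂ), (32/53469541125*(3089351265*pw a0 3 + 796256370*pw a0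
    2*a2 + 6510816298*pw a0 2 - 841634640*a0*pw a2 2 - 218141280*a0*a2 + 3003703920*a0 - 88372800*pw a2 3 -
    12220800*pw a2 2 + 222532800*a2) : ℂ), (1/1852200*(48620250*pw a0 4 - 101871000*pw a0 3*a2 + 504256305*pw
    a0 3 - 992250*pw a0 2*pw a2 2 - 49574280*pw a0 2*a2 + 174015905*pw a0 2 + 6520500*a0*pw a2 3 -
    49835940*a0*pw a2 2 + 42011424*a0*a2 + 4704588*a0 + 634500*pw a2 4 - 4768920*pw a2 3 + 3177090*pw a2 2 +
    511560*a2) : ℂ), (32/128753625*(-4659655*pw a0 3 + 5213208*pw a0 2*a2 - 23267062*pw a0 2 + 5489120*a0*pw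
    a2 2 - 1211280*a0*a2 - 22473360*a0 + 499200*pw a2 3 - 212800*pw a2 2 - 1646400*a2) : ℂ),
    (1/4630500*(-81033750*pw a0 4 + 439897500*pw a0 3*a2 - 2409811670*pw a0 3 - 287752500*pw a0 2*pw a2 2 +
    2239714589*pw a0 2*a2 - 2132072222*pw a0 2 - 29058750*a0*pw a2 3 + 274318380*a0*pw a2 2 - 81545310*a0*a2 -
    166327560*a0 + 3037500*pw a2 4 - 22728600*pw a2 3 + 41729100*pw a2 2 - 24563700*a2) : ℂ),
    (64/25750725*(-455455*pw a0 2*a2 + 1716715*pw a0 2 - 312312*a0*pw a2 2 + 580944*a0*a2 + 2247336*a0 -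
    27040*pw a2 3 + 58240*pw a2 2 + 164640*a2) : ℂ), (1/43218000*(189078750*pw a0 4 - 2917215000*pw a0 3*a2 +
    21617681330*pw a0 3 + 5533447500*pw a0 2*pw a2 2 - 50586131960*pw a0 2*a2 + 45262011431*pw a0 2 -
    1263465000*a0*pw a2 3 + 9842507220*a0*pw a2 2 - 14427764820*a0*a2 + 7295877540*a0 - 112927500*pw a2 4 +
    1416525000*pw a2 3 - 2100224700*pw a2 2 + 732324600*a2 + 43218000) : ℂ), (64/1576575*(-35035*pw a0 2 -
    24024*a0*a2 - 45864*a0 - 2080*pw a2 2 - 3360*a2) : ℂ), (1/926100*(16206750*pw a0 3*a2 - 223396929*pw a0 3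
    - 90294750*pw a0 2*pw a2 2 + 1160324949*pw a0 2*a2 - 1212212960*pw a0 2 + 70449750*a0*pw a2 3 -
    770741916*a0*pw a2 2 + 1085308560*a0*a2 - 401055984*a0 - 4252500*pw a2 4 + 12099600*pw a2 3 + 7722840*pw
    a2 2 + 4524240*a2 - 7408800) : ℂ), (0 : ℂ), (1/142619400*(6642770211*pw a0 3 + 3743759250*pw a0 2*pw a2 2
    - 91899799488*pw a0 2*a2 + 132783748433*pw a0 2 - 8913712500*a0*pw a2 3 + 145849975068*a0*pw a2 2 -
    251258335272*a0*a2 + 94970604204*a0 + 2393968500*pw a2 4 - 25794536760*pw a2 3 + 36245199480*pw a2 2 -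
    18140241000*a2 + 3993343200) : ℂ), (0 : ℂ), (1/103002900*(13403985231*pw a0 2*a2 - 36587462198*pw a0 2 +
    1802550750*a0*pw a2 3 - 58405280780*a0*pw a2 2 + 143794297990*a0*a2 - 65016904008*a0 - 1545043500*pw a2 4
    + 27778129240*pw a2 3 - 55377682220*pw a2 2 + 31035816000*a2 - 5768162400) : ℂ), (0 : ℂ),
    (1/16816800*(951998313*pw a0 2 + 2025180780*a0*pw a2 2 - 9646605556*a0*a2 + 6102615036*a0 + 73573500*pw a2
    4 - 2755329640*pw a2 3 + 8362060060*pw a2 2 - 5943134680*a2 + 1177176000) : ℂ), (0 : ℂ),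
    (1/107207100*(10373267247*a0*a2 - 12491060400*a0 + 3952182780*pw a2 3 - 24103699630*pw a2 2 +
    24924771900*a2 - 6003597600) : ℂ), (0 : ℂ), (1/6466460*(103961312*a0 + 262773173*pw a2 2 - 532196760*a2 +
    181060880) : ℂ), (0 : ℂ), (1/2717*(33329*a2 - 21736) : ℂ), (0 : ℂ), (1 : ℂ)]

set_option maxHeartbeats 4000000 in
noncomputable def qJ10 (a0 a2 : ℂ) : List ℂ :=
    [(4/180780518543625*(-10935525739320*pw a0 4 - 12596815657440*pw a0 3*a2 - 16588312110797*pw a0 3 -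
    2474440027920*pw a0 2*pw a2 2 - 1318488901338*pw a0 2*a2 + 1131289984104*pw a0 2 - 259910259840*a0*pw a2 3
    - 383946738672*a0*pw a2 2 - 229047711312*a0*a2 - 69701990400*a0 - 9784972800*pw a2 4 - 16771151040*pw a2 3
    - 11391065280*pw a2 2 - 2655313920*a2) : ℂ), (1/2852388000*(-99001633500*pw a0 4 - 58473954000*pw a0 3*a2
    - 11029761820*pw a0 3 - 12937617000*pw a0 2*pw a2 2 - 1816740464*pw a0 2*a2 + 1534686615*pw a0 2 -
    1270962000*a0*pw a2 3 - 295795500*a0*pw a2 2 - 90131580*a0*a2 - 91683900*a0 - 46777500*pw a2 4 -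
    13008600*pw a2 3 - 6860700*pw a2 2 - 3969000*a2) : ℂ), (64/2620007515125*(29942943030*pw a0 4 +
    1685100690*pw a0 3*a2 + 162841992971*pw a0 3 - 19891690140*pw a0 2*pw a2 2 + 80135345535*pw a0 2*a2 +
    166281255000*pw a0 2 - 2881418400*a0*pw a2 3 + 13760664120*a0*pw a2 2 + 8382357480*a0*a2 - 11824444800*a0
    - 139536000*pw a2 4 + 728733600*pw a2 3 + 133005600*pw a2 2 - 592704000*a2) : ℂ),
    (1/8557164000*(1453648234500*pw a0 4 - 267309504000*pw a0 3*a2 + 1472207983708*pw a0 3 - 311303223000*pw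
    a0 2*pw a2 2 + 583119008472*pw a0 2*a2 + 94385213307*pw a0 2 - 55625724000*a0*pw a2 3 + 94025810340*a0*pw
    a2 2 + 18679163580*a0*a2 - 12047264460*a0 - 2978167500*pw a2 4 + 4987045800*pw a2 3 + 946152900*pw a2 2 -
    721564200*a2) : ℂ), (8/524001503025*(-39923924040*pw a0 4 + 88973316432*pw a0 3*a2 - 765238789497*pw a0 3
    + 58989634704*pw a0 2*pw a2 2 - 174129951814*pw a0 2*a2 - 1174754485170*pw a0 2 - 10367462784*a0*pw a2 3 +
    81897507888*a0*pw a2 2 + 142505205696*a0*a2 - 236548018224*a0 - 1480942080*pw a2 4 + 10341186240*pw a2 3 +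
    12305475840*pw a2 2 - 18204903360*a2) : ℂ), (1/21609000*(-7183767990*pw a0 4 + 9720736620*pw a0 3*a2 -
    19807335219*pw a0 3 + 1269070110*pw a0 2*pw a2 2 - 51848566*pw a0 2*a2 - 4149689117*pw a0 2 -
    369757080*a0*pw a2 3 + 1239996940*a0*pw a2 2 - 860439510*a0*a2 - 42785820*a0 - 47389500*pw a2 4 +
    133593600*pw a2 3 - 61188750*pw a2 2 - 7408800*a2) : ℂ), (32/124762262625*(-4752848100*pw a0 3*a2 +
    50300975725*pw a0 3 + 814773960*pw a0 2*pw a2 2 - 18429734323*pw a0 2*a2 + 116700036306*pw a0 2 +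
    2511337920*a0*pw a2 3 - 25402696760*a0*pw a2 2 - 26427924600*a0*a2 + 64203919920*a0 + 241862400*pw a2 4 -
    2485549600*pw a2 3 - 1794223200*pw a2 2 + 4729636800*a2) : ℂ), (1/453789000*(147600490590*pw a0 4 -
    489019819680*pw a0 3*a2 + 970649170309*pw a0 3 + 178295784030*pw a0 2*pw a2 2 - 587535116910*pw a0 2*a2 +
    449041466685*pw a0 2 + 35932491000*a0*pw a2 3 - 108913902300*a0*pw a2 2 + 30133503540*a0*a2 +
    25282097820*a0 - 442872900*pw a2 4 + 1656963000*pw a2 3 - 5698138950*pw a2 2 + 3578450400*a2) : ℂ),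
    (4/128753625*(-160144985*pw a0 3 - 19619600*pw a0 2*pw a2 2 + 324970646*pw a0 2*a2 - 827661744*pw a0 2 -
    13453440*a0*pw a2 3 + 262946320*a0*pw a2 2 + 130030320*a0*a2 - 809040960*a0 - 1164800*pw a2 4 +
    23931200*pw a2 3 + 5006400*pw a2 2 - 59270400*a2) : ℂ), (1/544546800*(-86760351090*pw a0 4 +
    628735389912*pw a0 3*a2 - 1470206975902*pw a0 3 - 694300149396*pw a0 2*pw a2 2 + 2278834081020*pw a0 2*a2
    - 1408126333341*pw a0 2 + 60876700416*a0*pw a2 3 - 173773263468*a0*pw a2 2 + 270297246660*a0*a2 -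
    150898845132*a0 + 12911176980*pw a2 4 - 53094584760*pw a2 3 + 54554002020*pw a2 2 - 17063577720*a2 -
    544546800) : ℂ), (32/128753625*(-19164145*pw a0 2*a2 + 51501450*pw a0 2 - 13141128*a0*pw a2 2 +
    10227672*a0*a2 + 67420080*a0 - 1137760*pw a2 3 + 1219680*pw a2 2 + 4939200*a2) : ℂ),
    (1/9983358000*(311680652850*pw a0 4 - 5952383035200*pw a0 3*a2 + 19266802454018*pw a0 3 +
    15188119959180*pw a0 2*pw a2 2 - 60814633862220*pw a0 2*a2 + 39500299554513*pw a0 2 - 6444668316240*a0*pw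
    a2 3 + 24333628750620*a0*pw a2 2 - 23696781791340*a0*a2 + 7750312896060*a0 - 10906215300*pw a2 4 +
    917876547000*pw a2 3 - 1272594802500*pw a2 2 + 259154267400*a2 + 89850222000) : ℂ), (16/175175*(-35035*pw
    a0 2 - 24024*a0*a2 - 45864*a0 - 2080*pw a2 2 - 3360*a2) : ℂ), (1/1854052200*(224447311620*pw a0 3*a2 -
    1369590740217*pw a0 3 - 1543900000230*pw a0 2*pw a2 2 + 8779674052814*pw a0 2*a2 - 6879056465001*pw a0 2 +
    1630893809496*a0*pw a2 3 - 8108352586740*a0*pw a2 2 + 8580003146568*a0*a2 - 2564921880108*a0 -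
    214539247980*pw a2 4 + 686837048280*pw a2 3 - 559440716520*pw a2 2 + 255095091720*a2 - 66745879200) : ℂ),
    (0 : ℂ), (1/441441000*(52088010723*pw a0 3 + 77525528850*pw a0 2*pw a2 2 - 847231104930*pw a0 2*a2 +
    930669601085*pw a0 2 - 226878300600*a0*pw a2 3 + 1667545915732*a0*pw a2 2 - 2197456727788*a0*a2 +
    711964703100*a0 + 82821923100*pw a2 4 - 429774593160*pw a2 3 + 498304603680*pw a2 2 - 214776109800*a2 +
    37081044000) : ℂ), (0 : ℂ), (1/14008394400*(4484318278440*pw a0 2*a2 - 9372378825201*pw a0 2 +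
    1581904338000*a0*pw a2 3 - 22941933649964*a0*pw a2 2 + 43426661857348*a0*a2 - 17187128428764*a0 -
    1654823440060*pw a2 4 + 13595952120680*pw a2 3 - 21386858894940*pw a2 2 + 10643095769880*a2 -
    1765057694400) : ℂ), (0 : ℂ), (1/5431826400*(495581417667*pw a0 2 + 1558607544228*a0*pw a2 2 -
    5719367301732*a0*a2 + 3196409659604*a0 + 147435380820*pw a2 4 - 2482943807000*pw a2 3 + 5874612835460*pw
    a2 2 - 3728620268520*a2 + 684410126400) : ℂ), (0 : ℂ), (1/4752848100*(720576433479*a0*a2 - 770086779280*a0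
    + 403142234460*pw a2 3 - 1906034454005*pw a2 2 + 1762172422500*a2 - 399239240400) : ℂ), (0 : ℂ),
    (1/148728580*(2910418784*a0 + 9180269751*pw a2 2 - 16620389620*a2 + 5354228880) : ℂ), (0 : ℂ),
    (1/67925*(986827*a2 - 611325) : ℂ), (0 : ℂ), (1 : ℂ)]

open Polynomial in
noncomputable def QJ (a0 a2 : ℂ) : ℕ → ℂ[X]
  | 1 => 1
  | 2 => pl (qJ2 a0 a2)
  | 3 => pl (qJ3 a0 a2)
  | 4 => pl (qJ4 a0 a2)
  | 5 => pl (qJ5 a0 a2)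
  | 6 => pl (qJ6 a0 a2)
  | 7 => pl (qJ7 a0 a2)
  | 8 => pl (qJ8 a0 a2)
  | 9 => pl (qJ9 a0 a2)
  | 10 => pl (qJ10 a0 a2)
  | _ => 0

set_option maxHeartbeats 4000000 in
lemma qJ3_step (a0 a2 s : ℂ) : dv (qJ3 a0 a2) s =
    -(((0 : ℕ) + 2) * (pv (qJ2 a0 a2) s) * (Bp (0) (1)).eval s + ((0 : ℕ) + 1) * (1) * (Ap (1/7*(7*a0 + a2)) (0) (a2)).eval s
      + (0 : ℕ) * (0) * (4/15*(a0))) := by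
  simp only [qJ2, qJ3, Ap, Bp, eval_pl, dv, gv, pv, pw]
  push_cast
  ring

set_option maxHeartbeats 4000000 in
lemma qJ4_step (a0 a2 s : ℂ) : dv (qJ4 a0 a2) s =
    -(((1 : ℕ) + 2) * (pv (qJ3 a0 a2) s) * (Bp (0) (1)).eval s + ((1 : ℕ) + 1) * (pv (qJ2 a0 a2) s) * (Ap (1/7*(7*a0 + a2)) (0) (a2)).eval s
      + (1 : ℕ) * (1) * (4/15*(a0))) := by
  simp only [qJ2, qJ3, qJ4, Ap, Bp, eval_pl, dv, gv, pv, pw]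
  push_cast
  ring

set_option maxHeartbeats 4000000 in
lemma qJ5_step (a0 a2 s : ℂ) : dv (qJ5 a0 a2) s =
    -(((2 : ℕ) + 2) * (pv (qJ4 a0 a2) s) * (Bp (0) (1)).eval s + ((2 : ℕ) + 1) * (pv (qJ3 a0 a2) s) * (Ap (1/7*(7*a0 + a2)) (0) (a2)).eval s
      + (2 : ℕ) * (pv (qJ2 a0 a2) s) * (4/15*(a0))) := by
  simp only [qJ2, qJ3, qJ4, qJ5, Ap, Bp, eval_pl, dv, gv, pv, pw]
  push_cast
  ring

set_option maxHeartbeats 4000000 in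
lemma qJ6_step (a0 a2 s : ℂ) : dv (qJ6 a0 a2) s =
    -(((3 : ℕ) + 2) * (pv (qJ5 a0 a2) s) * (Bp (0) (1)).eval s + ((3 : ℕ) + 1) * (pv (qJ4 a0 a2) s) * (Ap (1/7*(7*a0 + a2)) (0) (a2)).eval s
      + (3 : ℕ) * (pv (qJ3 a0 a2) s) * (4/15*(a0))) := by
  simp only [qJ3, qJ4, qJ5, qJ6, Ap, Bp, eval_pl, dv, gv, pv, pw]
  push_cast
  ring

set_option maxHeartbeats 4000000 in
lemma qJ7_step (a0 a2 s : ℂ) : dv (qJ7 a0 a2) s =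
    -(((4 : ℕ) + 2) * (pv (qJ6 a0 a2) s) * (Bp (0) (1)).eval s + ((4 : ℕ) + 1) * (pv (qJ5 a0 a2) s) * (Ap (1/7*(7*a0 + a2)) (0) (a2)).eval s
      + (4 : ℕ) * (pv (qJ4 a0 a2) s) * (4/15*(a0))) := by
  simp only [qJ4, qJ5, qJ6, qJ7, Ap, Bp, eval_pl, dv, gv, pv, pw]
  push_cast
  ring

set_option maxHeartbeats 4000000 in
lemma qJ8_step (a0 a2 s : ℂ) : dv (qJ8 a0 a2) s =
    -(((5 : ℕ) + 2) * (pv (qJ7 a0 a2) s) * (Bp (0) (1)).eval s + ((5 : ℕ) + 1) * (pv (qJ6 a0 a2) s) * (Ap (1/7*(7*a0 + a2)) (0) (a2)).eval s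
      + (5 : ℕ) * (pv (qJ5 a0 a2) s) * (4/15*(a0))) := by
  simp only [qJ5, qJ6, qJ7, qJ8, Ap, Bp, eval_pl, dv, gv, pv, pw]
  push_cast
  ring

set_option maxHeartbeats 4000000 in
lemma qJ9_step (a0 a2 s : ℂ) : dv (qJ9 a0 a2) s =
    -(((6 : ℕ) + 2) * (pv (qJ8 a0 a2) s) * (Bp (0) (1)).eval s + ((6 : ℕ) + 1) * (pv (qJ7 a0 a2) s) * (Ap (1/7*(7*a0 + a2)) (0) (a2)).eval s
      + (6 : ℕ) * (pv (qJ6 a0 a2) s) * (4/15*(a0))) := by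
  simp only [qJ6, qJ7, qJ8, qJ9, Ap, Bp, eval_pl, dv, gv, pv, pw]
  push_cast
  ring

set_option maxHeartbeats 4000000 in
lemma qJ10_step (a0 a2 s : ℂ) : dv (qJ10 a0 a2) s =
    -(((7 : ℕ) + 2) * (pv (qJ9 a0 a2) s) * (Bp (0) (1)).eval s + ((7 : ℕ) + 1) * (pv (qJ8 a0 a2) s) * (Ap (1/7*(7*a0 + a2)) (0) (a2)).eval s
      + (7 : ℕ) * (pv (qJ7 a0 a2) s) * (4/15*(a0))) := by
  simp only [qJ7, qJ8, qJ9, qJ10, Ap, Bp, eval_pl, dv, gv, pv, pw]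
  push_cast
  ring

lemma qJ2_ini (a0 a2 : ℂ) : pv (qJ2 a0 a2) (-1) = 0 := by
  simp only [qJ2, pv, pw]
  ring

lemma qJ3_ini (a0 a2 : ℂ) : pv (qJ3 a0 a2) (-1) = 0 := by
  simp only [qJ3, pv, pw]
  ring

lemma qJ4_ini (a0 a2 : ℂ) : pv (qJ4 a0 a2) (-1) = 0 := by
  simp only [qJ4, pv, pw]
  ring

lemma qJ5_ini (a0 a2 : ℂ) : pv (qJ5 a0 a2) (-1) = 0 := by
  simp only [qJ5, pv, pw]
  ring

lemma qJ6_ini (a0 a2 : ℂ) : pv (qJ6 a0 a2) (-1) = 0 := by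
  simp only [qJ6, pv, pw]
  ring

lemma qJ7_ini (a0 a2 : ℂ) : pv (qJ7 a0 a2) (-1) = 0 := by
  simp only [qJ7, pv, pw]
  ring

lemma qJ8_ini (a0 a2 : ℂ) : pv (qJ8 a0 a2) (-1) = 0 := by
  simp only [qJ8, pv, pw]
  ring

lemma qJ9_ini (a0 a2 : ℂ) : pv (qJ9 a0 a2) (-1) = 0 := by
  simp only [qJ9, pv, pw]
  ring

lemma qJ10_ini (a0 a2 : ℂ) : pv (qJ10 a0 a2) (-1) = 0 := by
  simp only [qJ10, pv, pw]
  ring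

open Polynomial in
lemma FJ (a0 a2 : ℂ) : FocalSeq (4/15*(a0)) (Ap (1/7*(7*a0 + a2)) (0) (a2)) (Bp (0) (1)) 8 (QJ a0 a2) := by
  refine ⟨rfl, rfl, ?_, ?_, ?_⟩
  · intro s
    simp only [QJ, qJ2, eval_pl, deriv_pl, dv, gv, pv, pw, Ap, Bp]
    ring
  · intro n hn s
    interval_cases n
    · have := qJ3_step a0 a2 s
      simpa only [Nat.reduceAdd, QJ, eval_pl, deriv_pl, eval_one, eval_zero] using this
    · have := qJ4_step a0 a2 s
      simpa only [Nat.reduceAdd, QJ, eval_pl, deriv_pl, eval_one, eval_zero] using this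
    · have := qJ5_step a0 a2 s
      simpa only [Nat.reduceAdd, QJ, eval_pl, deriv_pl, eval_one, eval_zero] using this
    · have := qJ6_step a0 a2 s
      simpa only [Nat.reduceAdd, QJ, eval_pl, deriv_pl, eval_one, eval_zero] using this
    · have := qJ7_step a0 a2 s
      simpa only [Nat.reduceAdd, QJ, eval_pl, deriv_pl, eval_one, eval_zero] using this
    · have := qJ8_step a0 a2 s
      simpa only [Nat.reduceAdd, QJ, eval_pl, deriv_pl, eval_one, eval_zero] using this
    · have := qJ9_step a0 a2 s
      simpa only [Nat.reduceAdd, QJ, eval_pl, deriv_pl, eval_one, eval_zero] using this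
    · have := qJ10_step a0 a2 s
      simpa only [Nat.reduceAdd, QJ, eval_pl, deriv_pl, eval_one, eval_zero] using this
  · intro n hn
    interval_cases n
    · exact (eval_pl _ _).trans (qJ2_ini a0 a2)
    · exact (eval_pl _ _).trans (qJ3_ini a0 a2)
    · exact (eval_pl _ _).trans (qJ4_ini a0 a2)
    · exact (eval_pl _ _).trans (qJ5_ini a0 a2)
    · exact (eval_pl _ _).trans (qJ6_ini a0 a2)
    · exact (eval_pl _ _).trans (qJ7_ini a0 a2)
    · exact (eval_pl _ _).trans (qJ8_ini a0 a2)
    · exact (eval_pl _ _).trans (qJ9_ini a0 a2)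
    · exact (eval_pl _ _).trans (qJ10_ini a0 a2)

open Polynomial in
set_option maxHeartbeats 4000000 in
lemma LJ (a0 a2 : ℂ) (h : Cen (4/15*(a0)) (Ap (1/7*(7*a0 + a2)) (0) (a2)) (Bp (0) (1))) :
    -35035*a0^2 - 24024*a0*a2 - 45864*a0 - 2080*a2^2 - 3360*a2 = 0 ∧
    -712927215*a0^3 - 499974930*a0^2*a2 - 854404768*a0^2 - 153567120*a0*a2^2 - 444422160*a0*a2 - 93844800*a0 - 9302400*a2^3 - 24259200*a2^2 - 4704000*a2 = 0 ∧
    -678253027725*a0^4 - 554986416600*a0^3*a2 - 824142087916*a0^3 - 229333230000*a0^2*a2^2 - 701899981776*a0^2*a2 - 164857884576*a0^2 - 46604476800*a0*a2^3 - 195335895552*a0*a2^2 - 89115153792*a0*a2 - 8712748800*a0 - 2185920000*a2^4 - 8504509440*a2^3 - 3627348480*a2^2 - 331914240*a2 = 0 := by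
  have H := FJ a0 a2
  have h6 : pv (qJ6 a0 a2) 1 = 0 := (eval_pl _ _).symm.trans (h.focal H 4 (by norm_num))
  simp only [qJ6, pv, pw] at h6
  have h8 : pv (qJ8 a0 a2) 1 = 0 := (eval_pl _ _).symm.trans (h.focal H 6 (by norm_num))
  simp only [qJ8, pv, pw] at h8
  have h10 : pv (qJ10 a0 a2) 1 = 0 := (eval_pl _ _).symm.trans (h.focal H 8 (by norm_num))
  simp only [qJ10, pv, pw] at h10
  refine ⟨?_, ?_, ?_⟩
  · linear_combination (11036025/16) * h6
  · linear_combination (374286787875/64) * h8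
  · linear_combination (180780518543625/64) * h10

set_option maxHeartbeats 4000000 in
noncomputable def qK2 (b0 a1 a2 : ℂ) : List ℂ :=
    [(-b0 : ℂ), (-1 : ℂ), (b0 : ℂ), (1 : ℂ)]

set_option maxHeartbeats 4000000 in
noncomputable def qK3 (b0 a1 a2 : ℂ) : List ℂ :=
    [(pw b0 2 - b0*a1 + a2 : ℂ), (2*b0 - a1 : ℂ), (-2*pw b0 2 + b0*a1 - 2*a2 + 1 : ℂ), (-4*b0 + a1 : ℂ), (pw
    b0 2 + a2 - 2 : ℂ), (2*(b0) : ℂ), (1 : ℂ)]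

set_option maxHeartbeats 4000000 in
noncomputable def qK4 (b0 a1 a2 : ℂ) : List ℂ :=
    [(1/6*(-6*pw b0 3 + 15*pw b0 2*a1 - 14*b0*a2) : ℂ), (1/105*(-315*pw b0 2 + 525*b0*a1 - 283*a2) : ℂ),
    (1/2*(6*pw b0 3 - 10*pw b0 2*a1 + 14*b0*a2 - 6*b0 + 5*a1) : ℂ), (1/3*(27*pw b0 2 - 30*b0*a1 + 23*a2 - 3) :
    ℂ), (1/2*(-6*pw b0 3 + 5*pw b0 2*a1 - 14*b0*a2 + 18*b0 - 10*a1) : ℂ), (1/5*(-45*pw b0 2 + 25*b0*a1 - 37*a2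
    + 15) : ℂ), (1/6*(6*pw b0 3 + 14*b0*a2 - 54*b0 + 15*a1) : ℂ), (1/7*(21*pw b0 2 + 17*a2 - 21) : ℂ), (3*(b0)
    : ℂ), (1 : ℂ)]

set_option maxHeartbeats 4000000 in
noncomputable def qK5 (b0 a1 a2 : ℂ) : List ℂ :=
    [(1/210*(210*pw b0 4 - 910*pw b0 3*a1 + 315*pw b0 2*pw a1 2 + 805*pw b0 2*a2 - 630*b0*a1*a2 + 315*pw a2 2
    - 11*a2) : ℂ), (1/105*(420*pw b0 3 - 1365*pw b0 2*a1 + 315*b0*pw a1 2 + 916*b0*a2 - 315*a1*a2) : ℂ),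
    (1/210*(-840*pw b0 4 + 2730*pw b0 3*a1 - 630*pw b0 2*pw a1 2 - 3220*pw b0 2*a2 + 1260*pw b0 2 +
    1890*b0*a1*a2 - 2730*b0*a1 + 315*pw a1 2 - 1260*pw a2 2 + 1068*a2) : ℂ), (1/63*(-1008*pw b0 3 + 2457*pw b0
    2*a1 - 378*b0*pw a1 2 - 2120*b0*a2 + 252*b0 + 567*a1*a2 - 273*a1) : ℂ), (1/10*(60*pw b0 4 - 130*pw b0 3*a1
    + 15*pw b0 2*pw a1 2 + 230*pw b0 2*a2 - 240*pw b0 2 - 90*b0*a1*a2 + 390*b0*a1 - 30*pw a1 2 + 90*pw a2 2 -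
    186*a2 + 10) : ℂ), (1/15*(360*pw b0 3 - 585*pw b0 2*a1 + 45*b0*pw a1 2 + 736*b0*a2 - 240*b0 - 135*a1*a2 +
    195*a1) : ℂ), (1/30*(-120*pw b0 4 + 130*pw b0 3*a1 - 460*pw b0 2*a2 + 1080*pw b0 2 + 90*b0*a1*a2 -
    1170*b0*a1 + 45*pw a1 2 - 180*pw a2 2 + 788*a2 - 120) : ℂ), (1/105*(-1680*pw b0 3 + 1365*pw b0 2*a1 -
    3368*b0*a2 + 2520*b0 + 315*a1*a2 - 1365*a1) : ℂ), (1/210*(210*pw b0 4 + 805*pw b0 2*a2 - 5040*pw b0 2 +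
    2730*b0*a1 + 315*pw a2 2 - 3531*a2 + 1260) : ℂ), (1/63*(252*pw b0 3 + 500*b0*a2 - 1008*b0 + 273*a1) : ℂ),
    (2/35*(105*pw b0 2 + 72*a2 - 70) : ℂ), (4*(b0) : ℂ), (1 : ℂ)]

set_option maxHeartbeats 4000000 in
noncomputable def qK6 (b0 a1 a2 : ℂ) : List ℂ :=
    [(1/6306300*(-6306300*pw b0 5 + 40465425*pw b0 4*a1 - 36786750*pw b0 3*pw a1 2 - 34264230*pw b0 3*a2 +
    69894825*pw b0 2*a1*a2 + 279552*pw b0 2*a2 - 33002970*b0*pw a2 2 + 990990*b0*a2 - 165165*a1*a2 - 93184*pw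
    a2 2 + 224256*a2) : ℂ), (1/210*(-1050*pw b0 4 + 5390*pw b0 3*a1 - 3675*pw b0 2*pw a1 2 - 3833*pw b0 2*a2 +
    4918*b0*a1*a2 - 1383*pw a2 2 + 55*a2) : ℂ), (1/210*(1050*pw b0 5 - 5390*pw b0 4*a1 + 3675*pw b0 3*pw a1 2
    + 5705*pw b0 3*a2 - 2100*pw b0 3 - 9310*pw b0 2*a1*a2 + 8085*pw b0 2*a1 - 3675*b0*pw a1 2 + 5495*b0*pw a2
    2 - 4443*b0*a2 + 2611*a1*a2) : ℂ), (1/630*(15750*pw b0 4 - 64680*pw b0 3*a1 + 33075*pw b0 2*pw a1 2 +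
    56191*pw b0 2*a2 - 6300*pw b0 2 - 58096*b0*a1*a2 + 16170*b0*a1 - 3675*pw a1 2 + 19697*pw a2 2 - 5313*a2) :
    ℂ), (1/1260*(-12600*pw b0 5 + 48510*pw b0 4*a1 - 22050*pw b0 3*pw a1 2 - 68460*pw b0 3*a2 + 63000*pw b0 3
    + 83790*pw b0 2*a1*a2 - 194040*pw b0 2*a1 + 66150*b0*pw a1 2 - 65940*b0*pw a2 2 + 124208*b0*a2 - 6300*b0 -
    60510*a1*a2 + 8085*a1) : ℂ), (1/3150*(-157500*pw b0 4 + 485100*pw b0 3*a1 - 165375*pw b0 2*pw a1 2 -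
    549734*pw b0 2*a2 + 157500*pw b0 2 + 430500*b0*a1*a2 - 323400*b0*a1 + 55125*pw a1 2 - 188922*pw a2 2 +
    115578*a2 - 3150) : ℂ), (1/90*(900*pw b0 5 - 2310*pw b0 4*a1 + 525*pw b0 3*pw a1 2 + 4890*pw b0 3*a2 -
    9000*pw b0 3 - 3990*pw b0 2*a1*a2 + 20790*pw b0 2*a1 - 4725*b0*pw a1 2 + 4710*b0*pw a2 2 - 16894*b0*a2 +
    2250*b0 + 6324*a1*a2 - 2310*a1) : ℂ), (1/1470*(73500*pw b0 4 - 150920*pw b0 3*a1 + 25725*pw b0 2*pw a1 2 +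
    252070*pw b0 2*a2 - 147000*pw b0 2 - 132832*b0*a1*a2 + 226380*b0*a1 - 25725*pw a1 2 + 85274*pw a2 2 -
    99418*a2 + 7350) : ℂ), (1/420*(-2100*pw b0 5 + 2695*pw b0 4*a1 - 11410*pw b0 3*a2 + 42000*pw b0 3 +
    4655*pw b0 2*a1*a2 - 64680*pw b0 2*a1 + 7350*b0*pw a1 2 - 10990*b0*pw a2 2 + 75970*b0*a2 - 21000*b0 -
    19347*a1*a2 + 16170*a1) : ℂ), (1/630*(-15750*pw b0 4 + 16170*pw b0 3*a1 - 53335*pw b0 2*a2 + 63000*pw b0 2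
    + 14170*b0*a1*a2 - 64680*b0*a1 + 3675*pw a1 2 - 17833*pw a2 2 + 40185*a2 - 6300) : ℂ), (1/630*(630*pw b0 5
    + 3423*pw b0 3*a2 - 31500*pw b0 3 + 24255*pw b0 2*a1 + 3297*b0*pw a2 2 - 55501*b0*a2 + 31500*b0 +
    7191*a1*a2 - 16170*a1) : ℂ), (1/1386*(6930*pw b0 4 + 23293*pw b0 2*a2 - 69300*pw b0 2 + 35574*b0*a1 +
    7731*pw a2 2 - 42435*a2 + 13860) : ℂ), (1/252*(2520*pw b0 3 + 4372*b0*a2 - 6300*b0 + 1617*a1) : ℂ),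
    (1/91*(910*pw b0 2 + 544*a2 - 455) : ℂ), (5*(b0) : ℂ), (1 : ℂ)]

open Polynomial in
noncomputable def QK (b0 a1 a2 : ℂ) : ℕ → ℂ[X]
  | 1 => 1
  | 2 => pl (qK2 b0 a1 a2)
  | 3 => pl (qK3 b0 a1 a2)
  | 4 => pl (qK4 b0 a1 a2)
  | 5 => pl (qK5 b0 a1 a2)
  | 6 => pl (qK6 b0 a1 a2)
  | _ => 0

set_option maxHeartbeats 4000000 in
lemma qK3_step (b0 a1 a2 s : ℂ) : dv (qK3 b0 a1 a2) s =
    -(((0 : ℕ) + 2) * (pv (qK2 b0 a1 a2) s) * (Bp (b0) (1)).eval s + ((0 : ℕ) + 1) * (1) * (Ap (b0*a1 - a2) (a1) (a2)).eval s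
      + (0 : ℕ) * (0) * (32/105*(-a2))) := by
  simp only [qK2, qK3, Ap, Bp, eval_pl, dv, gv, pv, pw]
  push_cast
  ring

set_option maxHeartbeats 4000000 in
lemma qK4_step (b0 a1 a2 s : ℂ) : dv (qK4 b0 a1 a2) s =
    -(((1 : ℕ) + 2) * (pv (qK3 b0 a1 a2) s) * (Bp (b0) (1)).eval s + ((1 : ℕ) + 1) * (pv (qK2 b0 a1 a2) s) * (Ap (b0*a1 - a2) (a1) (a2)).eval s
      + (1 : ℕ) * (1) * (32/105*(-a2))) := by
  simp only [qK2, qK3, qK4, Ap, Bp, eval_pl, dv, gv, pv, pw]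
  push_cast
  ring

set_option maxHeartbeats 4000000 in
lemma qK5_step (b0 a1 a2 s : ℂ) : dv (qK5 b0 a1 a2) s =
    -(((2 : ℕ) + 2) * (pv (qK4 b0 a1 a2) s) * (Bp (b0) (1)).eval s + ((2 : ℕ) + 1) * (pv (qK3 b0 a1 a2) s) * (Ap (b0*a1 - a2) (a1) (a2)).eval s
      + (2 : ℕ) * (pv (qK2 b0 a1 a2) s) * (32/105*(-a2))) := by
  simp only [qK2, qK3, qK4, qK5, Ap, Bp, eval_pl, dv, gv, pv, pw]
  push_cast
  ring

set_option maxHeartbeats 4000000 in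
lemma qK6_step (b0 a1 a2 s : ℂ) : dv (qK6 b0 a1 a2) s =
    -(((3 : ℕ) + 2) * (pv (qK5 b0 a1 a2) s) * (Bp (b0) (1)).eval s + ((3 : ℕ) + 1) * (pv (qK4 b0 a1 a2) s) * (Ap (b0*a1 - a2) (a1) (a2)).eval s
      + (3 : ℕ) * (pv (qK3 b0 a1 a2) s) * (32/105*(-a2))) := by
  simp only [qK3, qK4, qK5, qK6, Ap, Bp, eval_pl, dv, gv, pv, pw]
  push_cast
  ring

lemma qK2_ini (b0 a1 a2 : ℂ) : pv (qK2 b0 a1 a2) (-1) = 0 := by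
  simp only [qK2, pv, pw]
  ring

lemma qK3_ini (b0 a1 a2 : ℂ) : pv (qK3 b0 a1 a2) (-1) = 0 := by
  simp only [qK3, pv, pw]
  ring

lemma qK4_ini (b0 a1 a2 : ℂ) : pv (qK4 b0 a1 a2) (-1) = 0 := by
  simp only [qK4, pv, pw]
  ring

lemma qK5_ini (b0 a1 a2 : ℂ) : pv (qK5 b0 a1 a2) (-1) = 0 := by
  simp only [qK5, pv, pw]
  ring

lemma qK6_ini (b0 a1 a2 : ℂ) : pv (qK6 b0 a1 a2) (-1) = 0 := by
  simp only [qK6, pv, pw]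
  ring

open Polynomial in
lemma FK (b0 a1 a2 : ℂ) : FocalSeq (32/105*(-a2)) (Ap (b0*a1 - a2) (a1) (a2)) (Bp (b0) (1)) 4 (QK b0 a1 a2) := by
  refine ⟨rfl, rfl, ?_, ?_, ?_⟩
  · intro s
    simp only [QK, qK2, eval_pl, deriv_pl, dv, gv, pv, pw, Ap, Bp]
    ring
  · intro n hn s
    interval_cases n
    · have := qK3_step b0 a1 a2 s
      simpa only [Nat.reduceAdd, QK, eval_pl, deriv_pl, eval_one, eval_zero] using this
    · have := qK4_step b0 a1 a2 s
      simpa only [Nat.reduceAdd, QK, eval_pl, deriv_pl, eval_one, eval_zero] using this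
    · have := qK5_step b0 a1 a2 s
      simpa only [Nat.reduceAdd, QK, eval_pl, deriv_pl, eval_one, eval_zero] using this
    · have := qK6_step b0 a1 a2 s
      simpa only [Nat.reduceAdd, QK, eval_pl, deriv_pl, eval_one, eval_zero] using this
  · intro n hn
    interval_cases n
    · exact (eval_pl _ _).trans (qK2_ini b0 a1 a2)
    · exact (eval_pl _ _).trans (qK3_ini b0 a1 a2)
    · exact (eval_pl _ _).trans (qK4_ini b0 a1 a2)
    · exact (eval_pl _ _).trans (qK5_ini b0 a1 a2)
    · exact (eval_pl _ _).trans (qK6_ini b0 a1 a2)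

open Polynomial in
set_option maxHeartbeats 4000000 in
lemma LK (b0 a1 a2 : ℂ) (h : Cen (32/105*(-a2)) (Ap (b0*a1 - a2) (a1) (a2)) (Bp (b0) (1))) :
    273*b0^2*a2 - 91*a2^2 + 219*a2 = 0 := by
  have H := FK b0 a1 a2
  have h6 : pv (qK6 b0 a1 a2) 1 = 0 := (eval_pl _ _).symm.trans (h.focal H 4 (by norm_num))
  simp only [qK6, pv, pw] at h6
  · linear_combination (1576575/512) * h6

set_option maxHeartbeats 4000000 in
noncomputable def qM2 (b0 a1 : ℂ) : List ℂ :=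
    [(-b0 : ℂ), (-1 : ℂ), (b0 : ℂ), (1 : ℂ)]

set_option maxHeartbeats 4000000 in
noncomputable def qM3 (b0 a1 : ℂ) : List ℂ :=
    [(1/91*(364*pw b0 2 - 91*b0*a1 + 219) : ℂ), (2*b0 - a1 : ℂ), (1/91*(-728*pw b0 2 + 91*b0*a1 - 347) : ℂ),
    (-4*b0 + a1 : ℂ), (1/91*(364*pw b0 2 + 37) : ℂ), (2*(b0) : ℂ), (1 : ℂ)]

set_option maxHeartbeats 4000000 in
noncomputable def qM4 (b0 a1 : ℂ) : List ℂ :=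
    [(1/26*(-208*pw b0 3 + 65*pw b0 2*a1 - 146*b0) : ℂ), (1/3185*(-35308*pw b0 2 + 15925*b0*a1 - 20659) : ℂ),
    (1/26*(624*pw b0 3 - 130*pw b0 2*a1 + 360*b0 + 65*a1) : ℂ), (2/91*(1456*pw b0 2 - 455*b0*a1 + 794) : ℂ),
    (1/26*(-624*pw b0 3 + 65*pw b0 2*a1 - 204*b0 - 130*a1) : ℂ), (1/455*(-14196*pw b0 2 + 2275*b0*a1 - 6738) :
    ℂ), (1/26*(208*pw b0 3 - 88*b0 + 65*a1) : ℂ), (12/637*(546*pw b0 2 + 151) : ℂ), (3*(b0) : ℂ), (1 : ℂ)]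

set_option maxHeartbeats 4000000 in
noncomputable def qM5 (b0 a1 : ℂ) : List ℂ :=
    [(1/248430*(6459180*pw b0 4 - 3312400*pw b0 3*a1 + 372645*pw b0 2*pw a1 2 + 7633626*pw b0 2 -
    1793610*b0*a1 + 2126928) : ℂ), (1/3185*(96096*pw b0 3 - 70070*pw b0 2*a1 + 9555*b0*pw a1 2 + 66868*b0 -
    22995*a1) : ℂ), (1/11830*(-1230320*pw b0 4 + 473200*pw b0 3*a1 - 35490*pw b0 2*pw a1 2 - 1209988*pw b0 2 +
    102440*b0*a1 + 17745*pw a1 2 - 266304) : ℂ), (2/1911*(-111748*pw b0 3 + 63063*pw b0 2*a1 - 5733*b0*pw a1 2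
    - 73558*b0 + 16555*a1) : ℂ), (1/82810*(12918360*pw b0 4 - 3312400*pw b0 3*a1 + 124215*pw b0 2*pw a1 2 +
    8737092*pw b0 2 + 1435980*b0*a1 - 248430*pw a1 2 + 692506) : ℂ), (1/455*(77896*pw b0 3 - 30030*pw b0 2*a1
    + 1365*b0*pw a1 2 + 46448*b0 - 3940*a1) : ℂ), (1/248430*(-25836720*pw b0 4 + 3312400*pw b0 3*a1 -
    2170896*pw b0 2 - 7895160*b0*a1 + 372645*pw a1 2 + 6077352) : ℂ), (2/3185*(-178724*pw b0 3 + 35035*pw b0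
    2*a1 - 84712*b0 - 9205*a1) : ℂ), (1/41405*(1076530*pw b0 4 - 1803529*pw b0 2 + 538265*b0*a1 - 1067322) :
    ℂ), (1/1911*(53144*pw b0 3 + 5924*b0 + 8281*a1) : ℂ), (2/3185*(29211*pw b0 2 + 9398) : ℂ), (4*(b0) : ℂ),
    (1 : ℂ)]

set_option maxHeartbeats 4000000 in
noncomputable def qM6 (b0 a1 : ℂ) : List ℂ :=
    [(1/496860*(-31997784*pw b0 5 + 19708780*pw b0 4*a1 - 2898350*pw b0 3*pw a1 2 - 43808856*pw b0 3 +
    13213746*pw b0 2*a1 - 14871852*b0 - 31317*a1) : ℂ), (1/1739010*(-206991876*pw b0 4 + 166812464*pw b0 3*a1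
    - 30432675*pw b0 2*pw a1 2 - 240392334*pw b0 2 + 98010822*b0*a1 - 65233968) : ℂ), (1/35490*(11427780*pw b0
    5 - 5631080*pw b0 4*a1 + 621075*pw b0 3*pw a1 2 + 13122174*pw b0 3 - 1096368*pw b0 2*a1 - 621075*b0*pw a1
    2 + 3571452*b0 + 1061931*a1) : ℂ), (1/1739010*(998125492*pw b0 4 - 659631336*pw b0 3*a1 + 91298025*pw b0
    2*pw a1 2 + 1096972786*pw b0 2 - 341297138*b0*a1 - 10144225*pw a1 2 + 279601680) : ℂ),
    (1/496860*(-319977840*pw b0 5 + 118252680*pw b0 4*a1 - 8695050*pw b0 3*pw a1 2 - 268649836*pw b0 3 -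
    68583060*pw b0 2*a1 + 26085150*b0*pw a1 2 - 35208448*b0 - 54235805*a1) : ℂ), (1/1739010*(-1936097800*pw b0
    4 + 980801640*pw b0 3*a1 - 91298025*pw b0 2*pw a1 2 - 1958016424*pw b0 2 + 393423940*b0*a1 + 30432675*pw
    a1 2 - 452241282) : ℂ), (1/248430*(159988920*pw b0 5 - 39417560*pw b0 4*a1 + 1449175*pw b0 3*pw a1 2 +
    55473236*pw b0 3 + 83250804*pw b0 2*a1 - 13042575*b0*pw a1 2 - 30717322*b0 + 35633962*a1) : ℂ),
    (1/1739010*(1889459208*pw b0 4 - 649959128*pw b0 3*a1 + 30432675*pw b0 2*pw a1 2 + 1647558276*pw b0 2 -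
    110365164*b0*a1 - 30432675*pw a1 2 + 309912906) : ℂ), (1/496860*(-159988920*pw b0 5 + 19708780*pw b0 4*a1
    + 99088080*pw b0 3 - 131926158*pw b0 2*a1 + 8695050*b0*pw a1 2 + 116144820*b0 - 35951799*a1) : ℂ),
    (1/1739010*(-928167604*pw b0 4 + 161976360*pw b0 3*a1 - 558419134*pw b0 2 - 84407050*b0*a1 + 10144225*pw
    a1 2 - 35537316) : ℂ), (1/248430*(15998892*pw b0 5 - 56057638*pw b0 3 + 18071508*pw b0 2*a1 - 32719072*b0
    + 447889*a1) : ℂ), (1/173901*(18367258*pw b0 4 - 3628079*pw b0 2 + 4463459*b0*a1 - 5456454) : ℂ),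
    (1/7644*(474292*pw b0 3 + 128056*b0 + 49049*a1) : ℂ), (1/8281*(231322*pw b0 2 + 77731) : ℂ), (5*(b0) : ℂ),
    (1 : ℂ)]

set_option maxHeartbeats 4000000 in
noncomputable def qM7 (b0 a1 : ℂ) : List ℂ :=
    [(1/17407490100*(3384016075440*pw b0 6 - 2673790479360*pw b0 5*a1 - 10718396416*pw b0 5 + 638274637000*pw
    b0 4*pw a1 2 + 3086626816*pw b0 4*a1 + 5997282050760*pw b0 4 - 43518725250*pw b0 3*pw a1 3 -
    2951417629160*pw b0 3*a1 - 16543514624*pw b0 3 + 314195631750*pw b0 2*pw a1 2 + 4952170496*pw b0 2*a1 +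
    3373959271683*pw b0 2 - 744437764070*b0*a1 - 6373654528*b0 + 1986310144*a1 + 585152895789) : ℂ),
    (1/248430*(88725000*pw b0 5 - 89150880*pw b0 4*a1 + 25257050*pw b0 3*pw a1 2 + 120494088*pw b0 3 -
    1863225*pw b0 2*pw a1 3 - 75987288*pw b0 2*a1 + 8968050*b0*pw a1 2 + 40522884*b0 - 10540689*a1) : ℂ),
    (1/791249550*(-922913475120*pw b0 6 + 607679654400*pw b0 5*a1 - 116049934000*pw b0 4*pw a1 2 -
    1376578255416*pw b0 4 + 5934371625*pw b0 3*pw a1 3 + 392950177620*pw b0 3*a1 + 27932848125*pw b0 2*pw a1 2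
    - 624562018626*pw b0 2 - 5934371625*b0*pw a1 3 + 1540810635*b0*a1 + 14281619625*pw a1 2 - 81513135024) :
    ℂ), (1/1739010*(-3618333264*pw b0 5 + 3089939216*pw b0 4*a1 - 707197400*pw b0 3*pw a1 2 - 4669360332*pw b0
    3 + 39127725*pw b0 2*pw a1 3 + 2324015148*pw b0 2*a1 - 152561500*b0*pw a1 2 - 1485463860*b0 - 4347525*pw
    a1 3 + 240647785*a1) : ℂ), (1/22607130*(65922391080*pw b0 6 - 34724551680*pw b0 5*a1 + 4973568600*pw b0
    4*pw a1 2 + 74633638716*pw b0 4 - 169553475*pw b0 3*pw a1 3 + 508519648*pw b0 3*a1 - 7272788250*pw b0 2*pw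
    a1 2 + 18981760980*pw b0 2 + 508660425*b0*pw a1 3 + 12615926869*b0*a1 - 1311917425*pw a1 2 - 526426944) :
    ℂ), (1/8695050*(43974693672*pw b0 5 - 30634665152*pw b0 4*a1 + 5303980500*pw b0 3*pw a1 2 + 52744390608*pw
    b0 3 - 195638625*pw b0 2*pw a1 3 - 18492416852*pw b0 2*a1 - 87587500*b0*pw a1 2 + 15405560376*b0 +
    65212875*pw a1 3 - 664374123*a1) : ℂ), (1/113035650*(-439482607200*pw b0 6 + 173622758400*pw b0 5*a1 -
    16578562000*pw b0 4*pw a1 2 - 274540191744*pw b0 4 + 282589125*pw b0 3*pw a1 3 - 189811450920*pw b0 3*a1 +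
    64747068750*pw b0 2*pw a1 2 + 99101413866*pw b0 2 - 2543302125*b0*pw a1 3 - 154193620035*b0*a1 +
    5836034750*pw a1 2 + 55104390294) : ℂ), (1/12173070*(-80126426016*pw b0 5 + 42598788960*pw b0 4*a1 -
    4950381800*pw b0 3*pw a1 2 - 85534585500*pw b0 3 + 91298025*pw b0 2*pw a1 3 + 15283092552*pw b0 2*a1 +
    2381106000*b0*pw a1 2 - 21360422676*b0 - 91298025*pw a1 3 - 2720275089*a1) : ℂ),
    (1/158249910*(461456737560*pw b0 6 - 121535930880*pw b0 5*a1 + 5802496700*pw b0 4*pw a1 2 - 88478940732*pw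
    b0 4 + 392415953748*pw b0 3*a1 - 65191137375*pw b0 2*pw a1 2 - 452231950443*pw b0 2 + 1186874325*b0*pw a1
    3 + 209293023849*b0*a1 + 2025946650*pw a1 2 - 128912241681) : ℂ), (1/1739010*(8418332104*pw b0 5 -
    3028063584*pw b0 4*a1 + 176799350*pw b0 3*pw a1 2 + 7180424888*pw b0 3 + 388360336*pw b0 2*a1 -
    331399250*b0*pw a1 2 + 1157985928*b0 + 4347525*pw a1 3 + 651793219*a1) : ℂ),
    (1/113035650*(-131844782160*pw b0 6 + 17362275840*pw b0 5*a1 + 237203547672*pw b0 4 - 167018660900*pw b0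
    3*a1 + 12151332375*pw b0 2*pw a1 2 + 299309553270*pw b0 2 - 55907170865*b0*a1 - 4365122125*pw a1 2 +
    65012939142) : ℂ), (1/19129110*(-36500925552*pw b0 5 + 6642686960*pw b0 4*a1 - 15699281052*pw b0 3 -
    10538857420*pw b0 2*a1 + 1083982900*b0*pw a1 2 + 3552942972*b0 - 3854023215*a1) : ℂ),
    (1/22607130*(4394826072*pw b0 6 - 29033815356*pw b0 4 + 7403942728*pw b0 3*a1 - 22824645480*pw b0 2 -
    555403121*b0*a1 + 320267675*pw a1 2 - 3210865452) : ℂ), (1/7535710*(2373864584*pw b0 5 - 1970748416*pw b0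
    3 + 1270934756*pw b0 2*a1 - 1675836664*b0 + 165811373*a1) : ℂ), (1/811538*(217160944*pw b0 4 + 48393982*pw
    b0 2 + 35301903*b0*a1 - 22328190) : ℂ), (1/82810*(9341332*pw b0 3 + 3183836*b0 + 720447*a1) : ℂ),
    (3/33124*(429793*pw b0 2 + 145671) : ℂ), (6*(b0) : ℂ), (1 : ℂ)]

set_option maxHeartbeats 4000000 in
noncomputable def qM8 (b0 a1 : ℂ) : List ℂ :=
    [(1/30699501390558000*(-16135657930877284800*pw b0 7 + 14784879869692732800*pw b0 6*a1 +
    98980220224471040*pw b0 6 - 4326583062642640800*pw b0 5*pw a1 2 - 36529364111851520*pw b0 5*a1 -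
    32519916118695385380*pw b0 5 + 402930955751073750*pw b0 4*pw a1 3 + 2041317495060480*pw b0 4*pw a1 2 +
    19468994048530026000*pw b0 4*a1 + 172798504489648128*pw b0 4 - 2783061611775244800*pw b0 3*pw a1 2 -
    55824332350259200*pw b0 3*a1 - 21642207811720756260*pw b0 3 + 3275080816250880*pw b0 2*pw a1 2 +
    6294411731775021855*pw b0 2*a1 + 90078574306459648*pw b0 2 + 7739937085280400*b0*pw a1 2 -
    21274732333137920*b0*a1 - 4747957367741547960*b0 + 1313631316408320*pw a1 2 - 23636093836089735*a1 +
    12158009732431872) : ℂ), (1/17407490100*(-21619107990480*pw b0 6 + 24381759562160*pw b0 5*a1 +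
    75028774912*pw b0 5 - 8491539456400*pw b0 4*pw a1 2 - 21606387712*pw b0 4*a1 - 37876020382200*pw b0 4 +
    913893230250*pw b0 3*pw a1 3 + 28443299564680*pw b0 3*a1 + 115804602368*pw b0 3 - 4881276109710*pw b0 2*pw
    a1 2 - 34665193472*pw b0 2*a1 - 20974880787861*pw b0 2 + 7876390331810*b0*a1 + 44615581696*b0 +
    6583146570*pw a1 2 - 13904171008*a1 - 3549534851643) : ℂ), (1/17407490100*(64045637575920*pw b0 7 -
    50300683392960*pw b0 6*a1 - 75028774912*pw b0 6 + 12266478023800*pw b0 5*pw a1 2 + 21606387712*pw b0 5*a1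
    + 109051164702480*pw b0 5 - 913893230250*pw b0 4*pw a1 3 - 39271476203960*pw b0 4*a1 - 115804602368*pw b0
    4 - 3174654342860*pw b0 3*pw a1 2 + 34665193472*pw b0 3*a1 + 58947706118301*pw b0 3 + 1370839845375*pw b0
    2*pw a1 3 + 3197835951310*pw b0 2*a1 - 44615581696*pw b0 2 - 5053462694280*b0*pw a1 2 + 13904171008*b0*a1
    + 9875191650423*b0 + 4345270234305*a1) : ℂ), (1/17407490100*(147045876657680*pw b0 6 - 144301129932960*pw
    b0 5*a1 - 75028774912*pw b0 5 + 42261738679160*pw b0 4*pw a1 2 + 21606387712*pw b0 4*a1 +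
    244763332261448*pw b0 4 - 3655572921000*pw b0 3*pw a1 3 - 151999029942760*pw b0 3*a1 - 115804602368*pw b0
    3 + 17316442823680*pw b0 2*pw a1 2 + 34665193472*pw b0 2*a1 + 128155950091169*pw b0 2 + 913893230250*b0*pw
    a1 3 - 36682982135800*b0*a1 - 44615581696*b0 - 1749521073300*pw a1 2 + 13904171008*a1 + 20373295183835) :
    ℂ), (1/3164998200*(-34933984132320*pw b0 7 + 22863946996800*pw b0 6*a1 - 4460537463200*pw b0 5*pw a1 2 -
    45982664788424*pw b0 5 + 249243608250*pw b0 4*pw a1 3 + 1365370948760*pw b0 4*a1 + 7115377370920*pw b0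
    3*pw a1 2 - 14795994655624*pw b0 3 - 996974433000*pw b0 2*pw a1 3 - 15297718549750*pw b0 2*a1 +
    4086598639760*b0*pw a1 2 + 110067549304*b0 + 41540601375*pw a1 3 - 4089132064290*a1) : ℂ),
    (1/3956247750*(-97496322694680*pw b0 6 + 80974549805240*pw b0 5*a1 - 19134192546560*pw b0 4*pw a1 2 -
    151585480413276*pw b0 4 + 1246218041250*pw b0 3*pw a1 3 + 72811152095500*pw b0 3*a1 - 3124805414185*pw b0
    2*pw a1 2 - 73335113435766*pw b0 2 - 830812027500*b0*pw a1 3 + 13366012554440*b0*a1 + 1823605673435*pw a1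
    2 - 10620816653424) : ℂ), (1/16147950*(297057688200*pw b0 7 - 155537054400*pw b0 6*a1 + 22757844200*pw b0
    5*pw a1 2 + 240202906944*pw b0 5 - 847767375*pw b0 4*pw a1 3 + 154255288096*pw b0 4*a1 - 86624725460*pw b0
    3*pw a1 2 - 56696261154*pw b0 3 + 7629906375*pw b0 2*pw a1 3 + 225922284211*pw b0 2*a1 - 34492742830*b0*pw
    a1 2 - 54867970158*b0 - 847767375*pw a1 3 + 42782670099*a1) : ℂ), (1/2769373425*(110880168668724*pw b0 6 -
    74775813416304*pw b0 5*a1 + 13352599906100*pw b0 4*pw a1 2 + 156182000492154*pw b0 4 - 581568419250*pw b0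
    3*pw a1 3 - 50296416309594*pw b0 3*a1 - 3281851556620*pw b0 2*pw a1 2 + 66522865506825*pw b0 2 +
    872352628875*b0*pw a1 3 - 3155191969566*b0*a1 - 2273933906335*pw a1 2 + 8108388792237) : ℂ),
    (1/3164998200*(-58223306887200*pw b0 7 + 22863946996800*pw b0 6*a1 - 2230268731600*pw b0 5*pw a1 2 -
    4602679006380*pw b0 5 + 41540601375*pw b0 4*pw a1 3 - 62084294451816*pw b0 4*a1 + 18319014218960*pw b0
    3*pw a1 2 + 58499235881268*pw b0 3 - 996974433000*pw b0 2*pw a1 3 - 57541105878711*pw b0 2*a1 +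
    4502570825480*b0*pw a1 2 + 23408590956024*b0 + 249243608250*pw a1 3 - 8071208678169*a1) : ℂ),
    (1/2373748650*(-92967059556280*pw b0 6 + 47660743322920*pw b0 5*a1 - 5709928038360*pw b0 4*pw a1 2 -
    111277832159676*pw b0 4 + 124621804125*pw b0 3*pw a1 3 + 14302493872940*pw b0 3*a1 + 6063970227315*pw b0
    2*pw a1 2 - 36328088469491*pw b0 2 - 498487216500*b0*pw a1 3 - 6789510801710*b0*a1 + 1590981618135*pw a1 2
    - 2497312051449) : ℂ), (1/1582499100*(17466992066160*pw b0 7 - 4572789399360*pw b0 6*a1 + 223026873160*pw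
    b0 5*pw a1 2 - 19354173667920*pw b0 5 + 28063329523320*pw b0 4*a1 - 4778306760500*pw b0 3*pw a1 2 -
    38091843731214*pw b0 3 + 124621804125*pw b0 2*pw a1 3 + 18254278598374*pw b0 2*a1 - 22409710960*b0*pw a1 2
    - 11638756629642*b0 - 83081202750*pw a1 3 + 1344142133152*a1) : ℂ), (1/1243392150*(28691940233320*pw b0 6
    - 9922773173040*pw b0 5*a1 + 597398792900*pw b0 4*pw a1 2 + 24458206455956*pw b0 4 + 4362292176060*pw b0
    3*a1 - 2095556972600*pw b0 2*pw a1 2 + 2084350583185*pw b0 2 + 65278087875*b0*pw a1 3 +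
    4563640204500*b0*a1 - 239837575250*pw a1 2 - 1089409093209) : ℂ), (1/4973568600*(-18298753593120*pw b0 7 +
    2395270637760*pw b0 6*a1 + 63281128832376*pw b0 5 - 39247987313080*pw b0 4*a1 + 3087544019560*pw b0 3*pw
    a1 2 + 74772870539640*pw b0 3 - 12637175235230*pw b0 2*a1 - 2045173049920*b0*pw a1 2 + 17348934307296*b0 +
    65278087875*pw a1 3 + 1997007862070*a1) : ℂ), (1/113148685650*(-858210693489240*pw b0 6 +
    149879273474840*pw b0 5*a1 - 147768685365756*pw b0 4 - 397603573776500*pw b0 3*a1 + 44286437009815*pw b0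
    2*pw a1 2 + 424084900443750*pw b0 2 - 175544199878320*b0*a1 - 5041673241605*pw a1 2 + 119311513186074) :
    ℂ), (1/133903770*(70379821512*pw b0 7 - 738864239568*pw b0 5 + 189001635368*pw b0 4*a1 - 543691094142*pw
    b0 3 - 91503366409*pw b0 2*a1 + 18434085670*b0*pw a1 2 - 48834893490*b0 - 50429783229*a1) : ℂ),
    (1/395624775*(424563060740*pw b0 6 - 789067467006*pw b0 4 + 330711589390*pw b0 3*a1 - 804075159461*pw b0 2
    + 35718966010*b0*a1 + 10892868805*pw a1 2 - 135684472149) : ℂ), (1/60285680*(55873662572*pw b0 5 -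
    3831090900*pw b0 3 + 19500786123*pw b0 2*a1 - 17504038168*b0 + 3521991837*a1) : ℂ),
    (1/256214140*(138806916976*pw b0 4 + 56296691633*pw b0 2 + 17140725966*b0*a1 - 2799296505) : ℂ),
    (1/23660*(4303299*pw b0 3 + 1628457*b0 + 263809*a1) : ℂ), (1/89908*(4606329*pw b0 2 + 1551227) : ℂ),
    (7*(b0) : ℂ), (1 : ℂ)]

set_option maxHeartbeats 4000000 in
noncomputable def qM9 (b0 a1 : ℂ) : List ℂ :=
    [(1/30699501390558000*(47467569050080779600*pw b0 8 - 51157649117225851200*pw b0 7*a1 -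
    572032201302016000*pw b0 7 + 19149666756288068000*pw b0 6*pw a1 2 + 289463307211653120*pw b0 6*a1 +
    112687459405423342440*pw b0 6 - 2865286796452080000*pw b0 5*pw a1 3 - 34744769085644800*pw b0 5*pw a1 2 -
    86419111675816019100*pw b0 5*a1 - 1202665784904450048*pw b0 5 + 134310318583691250*pw b0 4*pw a1 4 +
    19928699402686074000*pw b0 4*pw a1 2 + 514853710411808768*pw b0 4*a1 + 96466696317179528340*pw b0 4 -
    1292921308563885000*pw b0 3*pw a1 3 - 53345028191436800*pw b0 3*pw a1 2 - 45612491154634343940*pw b0 3*a1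
    - 835053896310652928*pw b0 3 + 4585754779945213875*pw b0 2*pw a1 2 + 282139463561166848*pw b0 2*a1 +
    34628232227590856400*pw b0 2 - 20434264921907200*b0*pw a1 2 - 7169086423777998720*b0*a1 -
    191238309075812352*b0 - 2858499491722875*pw a1 2 + 44442365011279872*a1 + 4228578414473142420) : ℂ),
    (1/7674875347639500*(29559935898940487040*pw b0 7 - 38343677236806942000*pw b0 6*a1 -
    197960440448942080*pw b0 6 + 16659596087942808000*pw b0 5*pw a1 2 + 106138539938529280*pw b0 5*a1 +
    59152560421334420040*pw b0 5 - 2775746584062952500*pw b0 4*pw a1 3 - 13608783300403200*pw b0 4*pw a1 2 -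
    54987790558946405160*pw b0 4*a1 - 345597008979296256*pw b0 4 + 134310318583691250*pw b0 3*pw a1 4 +
    14477963572457385000*pw b0 3*pw a1 2 + 162706334861557760*pw b0 3*a1 + 39046301342035707720*pw b0 3 -
    969690981422913750*pw b0 2*pw a1 3 - 21833872108339200*pw b0 2*pw a1 2 - 22106199534395041065*pw b0 2*a1 -
    180157148612919296*pw b0 2 + 2282052341756937750*b0*pw a1 2 + 62220251558133760*b0*a1 +
    8484994237768928880*b0 - 8757542109388800*pw a1 2 - 1760793500713702455*a1 - 24316019464863744) : ℂ),
    (1/7674875347639500*(-94935138100161559200*pw b0 8 + 89525885955145239600*pw b0 7*a1 +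
    396439310737899520*pw b0 7 - 28724500134432102000*pw b0 6*pw a1 2 - 163295429800222720*pw b0 6*a1 -
    190742477147925382680*pw b0 6 + 3581608495565100000*pw b0 5*pw a1 3 + 13608783300403200*pw b0 5*pw a1 2 +
    101245396674697154880*pw b0 5*a1 + 678843096614731776*pw b0 5 - 134310318583691250*pw b0 4*pw a1 4 -
    5727790396349521500*pw b0 4*pw a1 2 - 262155135902965760*pw b0 4*a1 - 132972915601358963130*pw b0 4 -
    2726548665167827500*pw b0 3*pw a1 3 + 21833872108339200*pw b0 3*pw a1 2 + 20245165521529233285*pw b0 3*a1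
    + 339701294051065856*pw b0 3 + 201465477875536875*pw b0 2*pw a1 4 + 9579939715360764750*pw b0 2*pw a1 2 -
    111430440233082880*pw b0 2*a1 - 36584111896422450360*pw b0 2 - 969690981422913750*b0*pw a1 3 +
    8757542109388800*b0*pw a1 2 - 4503396710398050465*b0*a1 + 40312043970330624*b0 + 1128126275736334875*pw a1
    2 - 4985062431498240*a1 - 3065895417208430070) : ℂ), (1/7674875347639500*(-230636875037354385600*pw b0 7 +
    265055304280491124400*pw b0 6*a1 + 462598934167552000*pw b0 6 - 99502931530872870000*pw b0 5*pw a1 2 -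
    182347726420787200*pw b0 5*a1 - 439299838322852587080*pw b0 5 + 13878732920314762500*pw b0 4*pw a1 3 +
    13608783300403200*pw b0 4*pw a1 2 + 344403097464747721400*pw b0 4*a1 + 754058370267611136*pw b0 4 -
    537241274334765000*pw b0 3*pw a1 4 - 67601431940744702000*pw b0 3*pw a1 2 - 284976018668257280*pw b0 3*a1
    - 275002496354547561600*pw b0 3 + 1311616517744032500*pw b0 2*pw a1 3 + 21833872108339200*pw b0 2*pw a1 2
    + 119659306420785136005*pw b0 2*a1 + 337523443747782656*pw b0 2 + 134310318583691250*b0*pw a1 4 -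
    4299724489892832000*b0*pw a1 2 - 111262487370711040*b0*a1 - 56439432455270144280*b0 -
    323230327140971250*pw a1 3 + 8757542109388800*pw a1 2 + 6145913798155746615*a1 + 24316019464863744) : ℂ),
    (1/3168163198200*(137161190237591520*pw b0 8 - 110867970223090080*pw b0 7*a1 - 95586659237888*pw b0 7 +
    29643446991158000*pw b0 6*pw a1 2 + 27526537945088*pw b0 6*a1 + 216047866461162736*pw b0 6 -
    2956952318320000*pw b0 5*pw a1 3 - 46410564602922520*pw b0 5*a1 - 71155770556416*pw b0 5 +
    83164283952750*pw b0 4*pw a1 4 - 28415487824523800*pw b0 4*pw a1 2 + 22168153792512*pw b0 4*a1 +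
    93852344280104410*pw b0 4 + 7628977598742500*pw b0 3*pw a1 3 + 62213292167546520*pw b0 3*a1 +
    61048834129920*pw b0 3 - 332657135811000*pw b0 2*pw a1 4 - 29751765162068950*pw b0 2*pw a1 2 -
    17575253090304*pw b0 2*a1 + 2095958158762468*pw b0 2 + 1354592854615000*b0*pw a1 3 +
    28353237760327480*b0*a1 + 45418662166528*b0 + 13860713992125*pw a1 4 - 1812589944815650*pw a1 2 -
    14154446086144*a1 - 3439266450778334) : ℂ), (1/43518725250*(4465045746921760*pw b0 7 - 4455488869071240*pw
    b0 6*a1 - 1500575498240*pw b0 6 + 1404706531828600*pw b0 5*pw a1 2 + 432127754240*pw b0 5*a1 +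
    7975338806731296*pw b0 5 - 157392722987500*pw b0 4*pw a1 3 - 5014342680182836*pw b0 4*a1 -
    2316092047360*pw b0 4 + 4569466151250*pw b0 3*pw a1 4 + 586647637676100*pw b0 3*pw a1 2 + 693303869440*pw
    b0 3*a1 + 4637067337658756*pw b0 3 + 45290160540625*pw b0 2*pw a1 3 - 1323938332362646*pw b0 2*a1 -
    892311633920*pw b0 2 - 3046310767500*b0*pw a1 4 - 106689001018600*b0*pw a1 2 + 278083420160*b0*a1 +
    873007802780124*b0 + 7387024645000*pw a1 3 + 14466863539656*a1) : ℂ),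
    (1/11880611993250*(-1028708926781936400*pw b0 8 + 692924813894313000*pw b0 7*a1 - 148217234955790000*pw b0
    6*pw a1 2 - 1063753751170790680*pw b0 6 + 11088571193700000*pw b0 5*pw a1 3 - 377192200851986520*pw b0
    5*a1 - 204828555509760*pw b0 5 - 207910709881875*pw b0 4*pw a1 4 + 396441756776615550*pw b0 4*pw a1 2 +
    58985438453760*pw b0 4*a1 + 161544269992909804*pw b0 4 - 62220897426187500*pw b0 3*pw a1 3 -
    1053939852258182890*pw b0 3*a1 - 316146564464640*pw b0 3 + 1871196388936875*pw b0 2*pw a1 4 +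
    261233148816815175*pw b0 2*pw a1 2 + 94635978178560*pw b0 2*a1 + 401352470043018494*pw b0 2 -
    2882571563746875*b0*pw a1 3 - 327545842644210190*b0*a1 - 121800538030080*b0 - 207910709881875*pw a1 4 +
    5039187967138325*pw a1 2 + 37958386851840*a1 + 85240229481374286) : ℂ),
    (1/27693734250*(-5548393402799520*pw b0 7 + 4674321426330920*pw b0 6*a1 - 1187598657445200*pw b0 5*pw a1 2
    - 9070747128302496*pw b0 5 + 100159005537500*pw b0 4*pw a1 3 + 4149478324626180*pw b0 4*a1 -
    1938561397500*pw b0 3*pw a1 4 - 34053336881200*pw b0 3*pw a1 2 - 4710541499803776*pw b0 3 -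
    92631990587500*pw b0 2*pw a1 3 + 459304904954350*pw b0 2*a1 + 2907842096250*b0*pw a1 4 +
    277674062047200*b0*pw a1 2 - 761298579257904*b0 - 6009185284375*pw a1 3 - 162204945855330*a1) : ℂ),
    (1/1440074181000*(155864988906354000*pw b0 8 - 83990886532644000*pw b0 7*a1 + 13474294086890000*pw b0 6*pw
    a1 2 + 48967317126273000*pw b0 6 - 672034617800000*pw b0 5*pw a1 3 + 164211137614369300*pw b0 5*a1 +
    6300324541875*pw b0 4*pw a1 4 - 74308852144017400*pw b0 4*pw a1 2 - 186117352529036292*pw b0 4 +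
    7845173350787500*pw b0 3*pw a1 3 + 229300950779724460*pw b0 3*a1 - 151207789005000*pw b0 2*pw a1 4 -
    33429015667299525*pw b0 2*pw a1 2 - 131706932221624032*pw b0 2 - 1120673112650000*b0*pw a1 3 +
    57269650981714080*b0*a1 + 37801947251250*pw a1 4 + 1822530315403525*pw a1 2 - 21868828929813468) : ℂ),
    (1/16616240550*(4071438950659808*pw b0 7 - 2778370767340168*pw b0 6*a1 + 532882306938800*pw b0 5*pw a1 2 +
    5824482517633416*pw b0 5 - 30047701661250*pw b0 4*pw a1 3 - 1492636494563396*pw b0 4*a1 + 290784209625*pw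
    b0 3*pw a1 4 - 328132933191700*pw b0 3*pw a1 2 + 2460729606036520*pw b0 3 + 66076184776875*pw b0 2*pw a1 3
    + 479503014630185*pw b0 2*a1 - 1163136838500*b0*pw a1 4 - 241118028383050*b0*pw a1 2 + 267317156914032*b0
    + 213028725000*pw a1 3 + 202197388831683*a1) : ℂ), (1/432022254300*(-37407597337524960*pw b0 8 +
    15118359575875920*pw b0 7*a1 - 1616915290426800*pw b0 6*pw a1 2 + 27325193877767968*pw b0 6 +
    40322077068000*pw b0 5*pw a1 3 - 64631885936336992*pw b0 5*a1 + 18072635044218300*pw b0 4*pw a1 2 +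
    95384507311352532*pw b0 4 - 1204068177721500*pw b0 3*pw a1 3 - 64683341570684018*pw b0 3*a1 +
    11340584175375*pw b0 2*pw a1 4 + 3752203733200650*pw b0 2*pw a1 2 + 50838962018643344*pw b0 2 +
    609123684828750*b0*pw a1 3 - 12072097934593606*b0*a1 - 7560389450250*pw a1 4 - 1284951378656400*pw a1 2 +
    7186154395891740) : ℂ), (1/26111235150*(-5021974600927648*pw b0 7 + 2599576727424040*pw b0 6*a1 -
    334241443481400*pw b0 5*pw a1 2 - 5684852501321448*pw b0 5 + 9443563379250*pw b0 4*pw a1 3 -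
    105934949244124*pw b0 4*a1 + 635380528528200*pw b0 3*pw a1 2 - 1342271483920640*pw b0 3 -
    56865583524750*pw b0 2*pw a1 3 - 1481156796162953*pw b0 2*a1 + 456946615125*b0*pw a1 4 +
    255142158180000*b0*pw a1 2 + 132499452781416*b0 + 5163664130625*pw a1 3 - 307253242104663*a1) : ℂ),
    (1/9504489594600*(411483570712774560*pw b0 8 - 110867970223090080*pw b0 7*a1 + 5928689398231600*pw b0 6*pw
    a1 2 - 1004153876828387376*pw b0 6 + 985428512434604056*pw b0 5*a1 - 166908525340666200*pw b0 4*pw a1 2 -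
    1828650650674073044*pw b0 4 + 5377957028944500*pw b0 3*pw a1 3 + 673289017348612392*pw b0 3*a1 +
    36041639134942350*pw b0 2*pw a1 2 - 781255456550547160*pw b0 2 - 8501644089939000*b0*pw a1 3 +
    46633648616037392*b0*a1 + 41582141976375*pw a1 4 + 24058260281978650*pw a1 2 - 88729921248135396) : ℂ),
    (1/16164097950*(1529946195275680*pw b0 7 - 533283219629160*pw b0 6*a1 + 34438130108200*pw b0 5*pw a1 2 +
    982671536135744*pw b0 5 + 635052566909852*pw b0 4*a1 - 198135594575100*pw b0 3*pw a1 2 -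
    369180409085384*pw b0 3 + 7448955138625*pw b0 2*pw a1 3 + 648782137824574*pw b0 2*a1 -
    37092186586000*b0*pw a1 2 - 231280574076888*b0 - 2619412796000*pw a1 3 + 85925965729994*a1) : ℂ),
    (1/792040799550*(-9797227874113680*pw b0 8 + 1319856788370120*pw b0 7*a1 + 57169620189796296*pw b0 6 -
    29979873790539400*pw b0 5*a1 + 2397116622960150*pw b0 4*pw a1 2 + 71194208083153428*pw b0 4 -
    6732161544822350*pw b0 3*a1 - 3419532988187225*pw b0 2*pw a1 2 + 21098808951459876*pw b0 2 +
    161708329908125*b0*pw a1 3 + 4453500858232790*b0*a1 - 691038335034775*pw a1 2 + 1069530773803248) : ℂ),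
    (1/339446056950*(-9065633693215008*pw b0 7 + 1593459971052040*pw b0 6*a1 + 2983366676891328*pw b0 5 -
    7387639369566092*pw b0 4*a1 + 795664873203200*pw b0 3*pw a1 2 + 10181065282297728*pw b0 3 -
    3899812161853062*pw b0 2*a1 - 189573196612800*b0*pw a1 2 + 2965165175754816*b0 + 13860713992125*pw a1 3 -
    117663166957518*a1) : ℂ), (1/905189485200*(1399603982016240*pw b0 8 - 22412711442222920*pw b0 6 +
    5218786345611020*pw b0 5*a1 - 15543336140349108*pw b0 4 - 5151231570687020*pw b0 3*a1 + 958201302283225*pw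
    b0 2*pw a1 2 + 1058608645746704*pw b0 2 - 3049014274371520*b0*a1 + 3741246283775*pw a1 2 +
    1150649704769004) : ℂ), (1/3847055312100*(12728327582850880*pw b0 7 - 41179656387177672*pw b0 5 +
    15527581785999920*pw b0 4*a1 - 39962215399360072*pw b0 3 - 801853935554035*pw b0 2*a1 +
    1081663718585450*b0*pw a1 2 - 6674321511711408*b0 - 2099983830018165*a1) : ℂ),
    (1/80707454100*(282755205092360*pw b0 6 - 149970470526422*pw b0 4 + 142608085735115*pw b0 3*a1 -
    256495130709832*pw b0 2 + 28909945715105*b0*a1 + 3782040974075*pw a1 2 - 48813208578378) : ℂ),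
    (1/53495260*(113712077752*pw b0 5 + 30583102592*pw b0 3 + 29467421529*pw b0 2*a1 - 15506317272*b0 +
    6107539867*a1) : ℂ), (1/374466820*(359153632383*pw b0 4 + 179968871838*pw b0 2 + 36023708084*b0*a1 +
    7889910667) : ℂ), (1/786695*(213114902*pw b0 3 + 85271066*b0 + 10811437*a1) : ℂ), (1/247247*(16021733*pw
    b0 2 + 5321075) : ℂ), (8*(b0) : ℂ), (1 : ℂ)]

open Polynomial in
noncomputable def QM (b0 a1 : ℂ) : ℕ → ℂ[X]
  | 1 => 1
  | 2 => pl (qM2 b0 a1)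
  | 3 => pl (qM3 b0 a1)
  | 4 => pl (qM4 b0 a1)
  | 5 => pl (qM5 b0 a1)
  | 6 => pl (qM6 b0 a1)
  | 7 => pl (qM7 b0 a1)
  | 8 => pl (qM8 b0 a1)
  | 9 => pl (qM9 b0 a1)
  | _ => 0

set_option maxHeartbeats 4000000 in
lemma qM3_step (b0 a1 s : ℂ) : dv (qM3 b0 a1) s =
    -(((0 : ℕ) + 2) * (pv (qM2 b0 a1) s) * (Bp (b0) (1)).eval s + ((0 : ℕ) + 1) * (1) * (Ap (1/91*(-273*b0^2 + 91*b0*a1 - 219)) (a1) (3/91*(91*b0^2 + 73))).eval s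
      + (0 : ℕ) * (0) * (32/3185*(-91*b0^2 - 73))) := by
  simp only [qM2, qM3, Ap, Bp, eval_pl, dv, gv, pv, pw]
  push_cast
  ring

set_option maxHeartbeats 4000000 in
lemma qM4_step (b0 a1 s : ℂ) : dv (qM4 b0 a1) s =
    -(((1 : ℕ) + 2) * (pv (qM3 b0 a1) s) * (Bp (b0) (1)).eval s + ((1 : ℕ) + 1) * (pv (qM2 b0 a1) s) * (Ap (1/91*(-273*b0^2 + 91*b0*a1 - 219)) (a1) (3/91*(91*b0^2 + 73))).eval s
      + (1 : ℕ) * (1) * (32/3185*(-91*b0^2 - 73))) := by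
  simp only [qM2, qM3, qM4, Ap, Bp, eval_pl, dv, gv, pv, pw]
  push_cast
  ring

set_option maxHeartbeats 4000000 in
lemma qM5_step (b0 a1 s : ℂ) : dv (qM5 b0 a1) s =
    -(((2 : ℕ) + 2) * (pv (qM4 b0 a1) s) * (Bp (b0) (1)).eval s + ((2 : ℕ) + 1) * (pv (qM3 b0 a1) s) * (Ap (1/91*(-273*b0^2 + 91*b0*a1 - 219)) (a1) (3/91*(91*b0^2 + 73))).eval s
      + (2 : ℕ) * (pv (qM2 b0 a1) s) * (32/3185*(-91*b0^2 - 73))) := by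
  simp only [qM2, qM3, qM4, qM5, Ap, Bp, eval_pl, dv, gv, pv, pw]
  push_cast
  ring

set_option maxHeartbeats 4000000 in
lemma qM6_step (b0 a1 s : ℂ) : dv (qM6 b0 a1) s =
    -(((3 : ℕ) + 2) * (pv (qM5 b0 a1) s) * (Bp (b0) (1)).eval s + ((3 : ℕ) + 1) * (pv (qM4 b0 a1) s) * (Ap (1/91*(-273*b0^2 + 91*b0*a1 - 219)) (a1) (3/91*(91*b0^2 + 73))).eval s
      + (3 : ℕ) * (pv (qM3 b0 a1) s) * (32/3185*(-91*b0^2 - 73))) := by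
  simp only [qM3, qM4, qM5, qM6, Ap, Bp, eval_pl, dv, gv, pv, pw]
  push_cast
  ring

set_option maxHeartbeats 4000000 in
lemma qM7_step (b0 a1 s : ℂ) : dv (qM7 b0 a1) s =
    -(((4 : ℕ) + 2) * (pv (qM6 b0 a1) s) * (Bp (b0) (1)).eval s + ((4 : ℕ) + 1) * (pv (qM5 b0 a1) s) * (Ap (1/91*(-273*b0^2 + 91*b0*a1 - 219)) (a1) (3/91*(91*b0^2 + 73))).eval s
      + (4 : ℕ) * (pv (qM4 b0 a1) s) * (32/3185*(-91*b0^2 - 73))) := by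
  simp only [qM4, qM5, qM6, qM7, Ap, Bp, eval_pl, dv, gv, pv, pw]
  push_cast
  ring

set_option maxHeartbeats 4000000 in
lemma qM8_step (b0 a1 s : ℂ) : dv (qM8 b0 a1) s =
    -(((5 : ℕ) + 2) * (pv (qM7 b0 a1) s) * (Bp (b0) (1)).eval s + ((5 : ℕ) + 1) * (pv (qM6 b0 a1) s) * (Ap (1/91*(-273*b0^2 + 91*b0*a1 - 219)) (a1) (3/91*(91*b0^2 + 73))).eval s
      + (5 : ℕ) * (pv (qM5 b0 a1) s) * (32/3185*(-91*b0^2 - 73))) := by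
  simp only [qM5, qM6, qM7, qM8, Ap, Bp, eval_pl, dv, gv, pv, pw]
  push_cast
  ring

set_option maxHeartbeats 4000000 in
lemma qM9_step (b0 a1 s : ℂ) : dv (qM9 b0 a1) s =
    -(((6 : ℕ) + 2) * (pv (qM8 b0 a1) s) * (Bp (b0) (1)).eval s + ((6 : ℕ) + 1) * (pv (qM7 b0 a1) s) * (Ap (1/91*(-273*b0^2 + 91*b0*a1 - 219)) (a1) (3/91*(91*b0^2 + 73))).eval s
      + (6 : ℕ) * (pv (qM6 b0 a1) s) * (32/3185*(-91*b0^2 - 73))) := by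
  simp only [qM6, qM7, qM8, qM9, Ap, Bp, eval_pl, dv, gv, pv, pw]
  push_cast
  ring

lemma qM2_ini (b0 a1 : ℂ) : pv (qM2 b0 a1) (-1) = 0 := by
  simp only [qM2, pv, pw]
  ring

lemma qM3_ini (b0 a1 : ℂ) : pv (qM3 b0 a1) (-1) = 0 := by
  simp only [qM3, pv, pw]
  ring

lemma qM4_ini (b0 a1 : ℂ) : pv (qM4 b0 a1) (-1) = 0 := by
  simp only [qM4, pv, pw]
  ring

lemma qM5_ini (b0 a1 : ℂ) : pv (qM5 b0 a1) (-1) = 0 := by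
  simp only [qM5, pv, pw]
  ring

lemma qM6_ini (b0 a1 : ℂ) : pv (qM6 b0 a1) (-1) = 0 := by
  simp only [qM6, pv, pw]
  ring

lemma qM7_ini (b0 a1 : ℂ) : pv (qM7 b0 a1) (-1) = 0 := by
  simp only [qM7, pv, pw]
  ring

lemma qM8_ini (b0 a1 : ℂ) : pv (qM8 b0 a1) (-1) = 0 := by
  simp only [qM8, pv, pw]
  ring

lemma qM9_ini (b0 a1 : ℂ) : pv (qM9 b0 a1) (-1) = 0 := by
  simp only [qM9, pv, pw]
  ring

open Polynomial in
lemma FM (b0 a1 : ℂ) : FocalSeq (32/3185*(-91*b0^2 - 73)) (Ap (1/91*(-273*b0^2 + 91*b0*a1 - 219)) (a1) (3/91*(91*b0^2 + 73))) (Bp (b0) (1)) 7 (QM b0 a1) := by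
  refine ⟨rfl, rfl, ?_, ?_, ?_⟩
  · intro s
    simp only [QM, qM2, eval_pl, deriv_pl, dv, gv, pv, pw, Ap, Bp]
    ring
  · intro n hn s
    interval_cases n
    · have := qM3_step b0 a1 s
      simpa only [Nat.reduceAdd, QM, eval_pl, deriv_pl, eval_one, eval_zero] using this
    · have := qM4_step b0 a1 s
      simpa only [Nat.reduceAdd, QM, eval_pl, deriv_pl, eval_one, eval_zero] using this
    · have := qM5_step b0 a1 s
      simpa only [Nat.reduceAdd, QM, eval_pl, deriv_pl, eval_one, eval_zero] using this
    · have := qM6_step b0 a1 s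
      simpa only [Nat.reduceAdd, QM, eval_pl, deriv_pl, eval_one, eval_zero] using this
    · have := qM7_step b0 a1 s
      simpa only [Nat.reduceAdd, QM, eval_pl, deriv_pl, eval_one, eval_zero] using this
    · have := qM8_step b0 a1 s
      simpa only [Nat.reduceAdd, QM, eval_pl, deriv_pl, eval_one, eval_zero] using this
    · have := qM9_step b0 a1 s
      simpa only [Nat.reduceAdd, QM, eval_pl, deriv_pl, eval_one, eval_zero] using this
  · intro n hn
    interval_cases n
    · exact (eval_pl _ _).trans (qM2_ini b0 a1)
    · exact (eval_pl _ _).trans (qM3_ini b0 a1)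
    · exact (eval_pl _ _).trans (qM4_ini b0 a1)
    · exact (eval_pl _ _).trans (qM5_ini b0 a1)
    · exact (eval_pl _ _).trans (qM6_ini b0 a1)
    · exact (eval_pl _ _).trans (qM7_ini b0 a1)
    · exact (eval_pl _ _).trans (qM8_ini b0 a1)
    · exact (eval_pl _ _).trans (qM9_ini b0 a1)

open Polynomial in
set_option maxHeartbeats 4000000 in
lemma LM (b0 a1 : ℂ) (h : Cen (32/3185*(-91*b0^2 - 73)) (Ap (1/91*(-273*b0^2 + 91*b0*a1 - 219)) (a1) (3/91*(91*b0^2 + 73))) (Bp (b0) (1))) :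
    -2616796*b0^5 + 753571*b0^4*a1 - 4038944*b0^3 + 1209026*b0^2*a1 - 1556068*b0 + 484939*a1 = 0 ∧
    -16278821599040*b0^6 + 769154848280*b0^5*a1 + 996737058135*b0^4*a1^2 - 15347742262944*b0^4 + 2593022242720*b0^3*a1 + 1599160554810*b0^2*a1^2 + 5564173212416*b0^2 + 1585149205640*b0*a1 + 641421541215*a1^2 + 5936528189664 = 0 ∧
    10679969926080*b0^7 - 11839142981120*b0^6*a1 + 2403608900875*b0^5*a1^2 + 35880151052928*b0^5 - 20329473875256*b0^4*a1 + 4149226103750*b0^3*a1^2 + 36424775395008*b0^3 - 10906632348976*b0^2*a1 + 1781726503375*b0*a1^2 + 11643568472832*b0 - 1778563923864*a1 = 0 := by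
  have H := FM b0 a1
  have h7 : pv (qM7 b0 a1) 1 = 0 := (eval_pl _ _).symm.trans (h.focal H 5 (by norm_num))
  simp only [qM7, pv, pw] at h7
  have h8 : pv (qM8 b0 a1) 1 = 0 := (eval_pl _ _).symm.trans (h.focal H 6 (by norm_num))
  simp only [qM8, pv, pw] at h8
  have h9 : pv (qM9 b0 a1) 1 = 0 := (eval_pl _ _).symm.trans (h.focal H 7 (by norm_num))
  simp only [qM9, pv, pw] at h9
  refine ⟨?_, ?_, ?_⟩
  · linear_combination (4351872525/2048) * h7
  · linear_combination (1918718836909875/256) * h8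
  · linear_combination (1918718836909875/1024) * h9

lemma algJ (r a0 : ℂ) (h0 : ((-35035) + (-24024)*r^1 + (-2080)*r^2)*a0 + ((-45864) + (-3360)*r^1) = 0)
    (h1 : ((-93844800) + (-4704000)*r^1)*a0^0 + ((-854404768) + (-444422160)*r^1 + (-24259200)*r^2)*a0^1 + ((-712927215) + (-499974930)*r^1 + (-153567120)*r^2 + (-9302400)*r^3)*a0^2 = 0)
    (h2 : ((-8712748800) + (-331914240)*r^1)*a0^0 + ((-164857884576) + (-89115153792)*r^1 + (-3627348480)*r^2)*a0^1 + ((-824142087916) + (-701899981776)*r^1 + (-195335895552)*r^2 + (-8504509440)*r^3)*a0^2 + ((-678253027725) + (-554986416600)*r^1 + (-229333230000)*r^2 + (-46604476800)*r^3 + (-2185920000)*r^4)*a0^3 = 0) : False := by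
  have r1 : ((-241940708153464320) + (320932985757715968)*r^1 + (170521427220318720)*r^2 + (28505468717107200)*r^3 + (1901558808576000)*r^4 + (44170936320000)*r^5) = 0 := by
    linear_combination ((-35035) + (-24024)*r^1 + (-2080)*r^2)^2 * h1 - (((-854404768) + (-444422160)*r^1 + (-24259200)*r^2)*((-35035) + (-24024)*r^1 + (-2080)*r^2)^1*((((-35035) + (-24024)*r^1 + (-2080)*r^2)*a0)^0*((45864) + (3360)*r^1)^0) + ((-712927215) + (-499974930)*r^1 + (-153567120)*r^2 + (-9302400)*r^3)*((-35035) + (-24024)*r^1 + (-2080)*r^2)^0*((((-35035) + (-24024)*r^1 + (-2080)*r^2)*a0)^0*((45864) + (3360)*r^1)^1+(((-35035) + (-24024)*r^1 + (-2080)*r^2)*a0)^1*((45864) + (3360)*r^1)^0)) * h0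
  have r2 : ((-13604476927746945970679040) + (16710959392654452922773504)*r^1 + (19307252292178291161477120)*r^2 + (6983449685422742362521600)*r^3 + (1172842896216380270837760)*r^4 + (99409529714300131737600)*r^5 + (4130803759020244992000)*r^6 + (67044570436730880000)*r^7) = 0 := by
    linear_combination ((-35035) + (-24024)*r^1 + (-2080)*r^2)^3 * h2 - (((-164857884576) + (-89115153792)*r^1 + (-3627348480)*r^2)*((-35035) + (-24024)*r^1 + (-2080)*r^2)^2*((((-35035) + (-24024)*r^1 + (-2080)*r^2)*a0)^0*((45864) + (3360)*r^1)^0) + ((-824142087916) + (-701899981776)*r^1 + (-195335895552)*r^2 + (-8504509440)*r^3)*((-35035) + (-24024)*r^1 + (-2080)*r^2)^1*((((-35035) + (-24024)*r^1 + (-2080)*r^2)*a0)^0*((45864) + (3360)*r^1)^1+(((-35035) + (-24024)*r^1 + (-2080)*r^2)*a0)^1*((45864) + (3360)*r^1)^0) + ((-678253027725) + (-554986416600)*r^1 + (-229333230000)*r^2 + (-46604476800)*r^3 + (-2185920000)*r^4)*((-35035) + (-24024)*r^1 + (-2080)*r^2)^0*((((-35035) + (-24024)*r^1 + (-2080)*r^2)*a0)^0*((45864)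 + (3360)*r^1)^2+(((-35035) + (-24024)*r^1 + (-2080)*r^2)*a0)^1*((45864) + (3360)*r^1)^1+(((-35035) + (-24024)*r^1 + (-2080)*r^2)*a0)^2*((45864) + (3360)*r^1)^0)) * h0
  have : (133192057328332437330445782649614648643553683933804365705251978393273618313896018973703683669623040 : ℂ) = 0 := by
    linear_combination ((-2113644731757746698829565612464298322935145306352104532354465277175550797589084286) + (-1858173030266212924375644980197843115116504452504868006308460310934829022993047080)*r^1 + (-692686229351207130499932761146258548683175110429269588716871105842198929674776000)*r^2 + (-114040202907538826666794639645696572743085037045933174134205494116682213126339840)*r^3 + (-9639526261884356957762446574568142280728732054878885387465978724701905275238400)*r^4 + (-411514759160625063226044516280772456866346186543524219113259828170191536128000)*r^5 + (-6995397155158303061895513041839688516669280079945925250633058864973905920000)*r^6) * r1 + ((27798543660774729672314584854349992075732587019167574305987624251910559487) + (17330303822962226515554594658049288271652854476267457839468559818567027980)*r^1 + (2729819114867987793625392909882136091439767723988298734168107711105007300)*r^2 + (185566290517427655422888821500447049770399087554775188745890076406784000)*r^3 + (4608773540658294026404154663302347607842007966831630555133757418880000)*r^4) * r2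
  norm_num at this

lemma algM (x y : ℂ) (h0 : ((6643) + (8281)*x^1)*y + ((-21316) + (-28756)*x^1) = 0)
    (h1 : ((81322303968) + (-25152828064)*x^1 + (-178888149440)*x^2)*y^0 + ((21714372680)*x^1 + (8452251080)*x^2)*y^1 + ((8786596455)*x^1 + (10953154485)*x^2)*y^2 = 0)
    (h2 : ((159500937984) + (300139589568)*x^1 + (117362306880)*x^2)*y^0 + ((-24363889368) + (-119034498856)*x^1 + (-130100472320)*x^2)*y^1 + ((24407212375)*x^1 + (26413284625)*x^2)*y^2 = 0) : False := by
  have r1 : ((3588708465518353632) + (14904395347287317872)*x^1 + (19841452757910418544)*x^2 + (7564467609763866256)*x^3 + (-1197280554231762000)*x^4) = 0 := by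
    linear_combination ((6643) + (8281)*x^1)^2 * h1 - (((21714372680)*x^1 + (8452251080)*x^2)*((6643) + (8281)*x^1)^1*((((6643) + (8281)*x^1)*y)^0*((21316) + (28756)*x^1)^0) + ((8786596455)*x^1 + (10953154485)*x^2)*((6643) + (8281)*x^1)^0*((((6643) + (8281)*x^1)*y)^0*((21316) + (28756)*x^1)^1+(((6643) + (8281)*x^1)*y)^1*((21316) + (28756)*x^1)^0)) * h0
  have r2 : ((3588708465518353632) + (16073111672185962576)*x^1 + (23086905661459749200)*x^2 + (9894522136535104432)*x^3 + (-1091162272331425840)*x^4) = 0 := by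
    linear_combination ((6643) + (8281)*x^1)^2 * h2 - (((-24363889368) + (-119034498856)*x^1 + (-130100472320)*x^2)*((6643) + (8281)*x^1)^1*((((6643) + (8281)*x^1)*y)^0*((21316) + (28756)*x^1)^0) + ((24407212375)*x^1 + (26413284625)*x^2)*((6643) + (8281)*x^1)^0*((((6643) + (8281)*x^1)*y)^0*((21316) + (28756)*x^1)^1+(((6643) + (8281)*x^1)*y)^1*((21316) + (28756)*x^1)^0)) * h0
  have : (6491624757914550477948141124184198538004504203004767593115877995154890742080000 : ℂ) = 0 := by
    linear_combination ((8214597741546139009446803653182944542936728110838019966043471305938) + (25643399207540932375606434104182998866894024966783585009653876719513)*x^1 + (18046076404948067867285325765243929824161132479070150699824399731604)*x^2 + (-1840533767951240220781216587208300642913131226097410747037461321305)*x^3) * r1 + ((-8214595932643348412635494683467419166296160730914502845004910115938) + (-22968201291474698093751837792381961450658041611790312466027446606927)*x^1 + (-14247731431983530623933720615352794148996147505101467578570725238112)*x^2 + (2019530317032084474346733773905734099242282175607904066933755333375)*x^3) * r2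
  norm_num at this

open Polynomial in
lemma L2 (e α0 α1 α2 α3 β0 β1 β2 : ℂ) (h : Cen e (pl [α0, α1, α2, α3]) (pl [β0, β1, β2])) :
    3 * β0 + β2 = 0 ∧ 3 * α0 + α2 = 0 := by
  let Q : ℕ → ℂ[X] := fun n => match n with
    | 1 => 1
    | 2 => - pl [β0 - β1 / 2 + β2 / 3, β0, β1 / 2, β2 / 3]
    | 3 => pl [β0 - β1 / 2 + β2 / 3, β0, β1 / 2, β2 / 3] ^ 2
        - pl [α0 - α1 / 2 + α2 / 3 - α3 / 4, α0, α1 / 2, α2 / 3, α3 / 4]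
    | _ => 0
  have H : FocalSeq e (pl [α0, α1, α2, α3]) (pl [β0, β1, β2]) 1 Q := by
    refine ⟨rfl, rfl, ?_, ?_, ?_⟩
    · intro s
      simp only [Q, derivative_neg, eval_neg, eval_pl, deriv_pl, dv, gv, pv]
      ring
    · intro n hn s
      interval_cases n
      simp only [Q, Nat.reduceAdd, derivative_neg, eval_neg, derivative_sub, derivative_pow, eval_sub, eval_mul,
        eval_pow, eval_C, eval_one, eval_zero, eval_pl, deriv_pl, dv, gv, pv]
      push_cast
      ring
    · intro n hn
      interval_cases n
      · simp only [Q, Nat.reduceAdd, eval_neg, eval_pl, pv]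
        ring
      · simp only [Q, Nat.reduceAdd, eval_sub, eval_pow, eval_pl, pv]
        ring
  have h2 := h.focal H 0 (by norm_num)
  have h3 := h.focal H 1 (by norm_num)
  simp only [Q, Nat.reduceAdd, eval_sub, eval_pow, eval_neg, eval_pl, pv] at h2 h3
  constructor
  · linear_combination (-3/2) * h2
  · linear_combination (-3/2) * h3 + (-3/2) * (β0 - β1 / 2 + β2 / 3 + (β0 + β1 / 2 + β2 / 3)) * h2

open Polynomial in
lemma norm_case (e b0 a0 a1 a2 : ℂ) (he : e ≠ 0) (h : Cen e (Ap a0 a1 a2) (Bp b0 1)) : False := by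
  obtain ⟨h4, h5⟩ := LG b0 1 a0 a1 a2 e h
  by_cases hb : b0 = 0
  · subst hb
    obtain ⟨α, rfl⟩ : ∃ α, a0 = 1/7*(7*α + a2) := ⟨a0 - a2 / 7, by ring⟩
    obtain rfl : e = 4/15*α := by linear_combination (-1/105) * h4
    have hα : α ≠ 0 := by rintro rfl; simp at he
    obtain ⟨h6, h7⟩ := LI α a1 a2 h
    by_cases ha : a1 = 0
    · subst ha
      obtain ⟨-, h8, h10⟩ := LJ α a2 h
      obtain ⟨r, rfl⟩ : ∃ r, a2 = α * r := ⟨a2 / α, by field_simp⟩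
      refine algJ r α ?_ ?_ ?_
      · apply mul_left_cancel₀ hα
        linear_combination h6
      · apply mul_left_cancel₀ hα
        linear_combination h8
      · apply mul_left_cancel₀ hα
        linear_combination h10
    · have h7' : -273 * α - 20 * a2 = 0 := by
        apply mul_left_cancel₀ ha
        linear_combination h7
      obtain rfl : a2 = -273/20 * α := by linear_combination (-1/20) * h7'
      apply hα
      have : α ^ 2 = 0 := by
        linear_combination (-5/473291) * h6
      exact pow_eq_zero_iff (two_ne_zero) |>.mp this
  · have h5' : -24*b0*a1 + 24*a0 - 8*a2 - 105*e = 0 := by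
      apply mul_left_cancel₀ hb
      linear_combination h5
    obtain rfl : a0 = b0 * a1 - a2 := by linear_combination (1/4) * h4 - (1/4) * h5'
    obtain rfl : e = 32/105*(-a2) := by linear_combination (-1/105) * h4
    have ha : a2 ≠ 0 := by rintro rfl; simp at he
    have h6 := LK b0 a1 a2 h
    have h6' : 273*b0^2 - 91*a2 + 219 = 0 := by
      apply mul_left_cancel₀ ha
      linear_combination h6
    obtain rfl : a2 = 3/91*(91*b0^2 + 73) := by linear_combination (-1/91) * h6'
    have hD : 91*b0^2 + 73 ≠ 0 := by
      intro h0; rw [h0] at ha; simp at ha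
    have hM : Cen (32/3185*(-91*b0^2 - 73)) (Ap (1/91*(-273*b0^2 + 91*b0*a1 - 219)) (a1) (3/91*(91*b0^2 + 73))) (Bp (b0) (1)) := by
      have e1 : 32/3185*(-91*b0^2 - 73) = 32/105*(-(3/91*(91*b0^2 + 73))) := by ring
      have e2 : 1/91*(-273*b0^2 + 91*b0*a1 - 219) = b0*a1 - 3/91*(91*b0^2 + 73) := by ring
      rw [e1, e2]
      exact h
    obtain ⟨h7, h8, h9⟩ := LM b0 a1 hM
    obtain ⟨y, rfl⟩ : ∃ y, a1 = b0 * y := ⟨a1 / b0, by field_simp⟩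
    refine algM (b0 ^ 2) y ?_ ?_ ?_
    · apply mul_left_cancel₀ hD
      apply mul_left_cancel₀ hb
      linear_combination h7
    · apply mul_left_cancel₀ hD
      linear_combination h8
    · apply mul_left_cancel₀ hD
      apply mul_left_cancel₀ hb
      linear_combination h9

open Polynomial in
lemma Bp_scale (k b0 b1 : ℂ) : C k * Bp b0 b1 = Bp (k * b0) (k * b1) := by
  simp only [Bp, pl, map_mul, map_neg, map_ofNat]; ring

open Polynomial in
lemma Ap_scale (k a0 a1 a2 : ℂ) : C k * Ap a0 a1 a2 = Ap (k * a0) (k * a1) (k * a2) := by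
  simp only [Ap, pl, map_mul, map_neg, map_sub, map_ofNat]; ring

open Polynomial in
lemma gen_case (α0 α1 α2 α3 β0 β1 β2 : ℂ)
    (h : Cen (1/2) (pl [α0, α1, α2, α3]) (pl [β0, β1, β2])) : False := by
  obtain ⟨h2, h3⟩ := L2 _ _ _ _ _ _ _ _ h
  have hA : pl [α0, α1, α2, α3] = Ap (-α3/4 - α1/2) α0 (-α3/4) := by
    rw [Ap]
    congr 3
    · ring
    · congr 1
      · linear_combination h3
      · congr 1; ring
  have hB : pl [β0, β1, β2] = Bp (-β1/2) β0 := by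
    rw [Bp]
    congr 3
    · ring
    · congr 1; linear_combination h2
  rw [hA, hB] at h
  generalize -α3/4 - α1/2 = a0 at h
  generalize -α3/4 = a2 at h
  generalize -β1/2 = b0 at h
  obtain ⟨h4, h5⟩ := LG _ _ _ _ _ _ h
  have hb1 : β0 ≠ 0 := by
    rintro rfl
    have hb0 : b0 ≠ 0 := by
      rintro rfl; norm_num at h4
    have h5' : -24*b0*α0 - 105/2 = 0 := by
      apply mul_left_cancel₀ hb0
      linear_combination h5
    have : (1 : ℂ) = 0 := by linear_combination (-28/210) * h5' + (24/210) * h4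
    exact one_ne_zero this
  have h' := h.scale β0⁻¹ (inv_ne_zero hb1)
  rw [Ap_scale, Bp_scale, inv_mul_cancel₀ hb1] at h'
  exact norm_case _ _ _ _ _ (mul_ne_zero (pow_ne_zero _ (inv_ne_zero hb1)) (by norm_num)) h'

open Polynomial in
lemma bridge (A B : ℂ[X]) (h : IsCenter 1 (fun t z =>
      z ^ 4 + A.eval (t : ℂ) * z ^ 3 + B.eval (t : ℂ) * z ^ 2)) :
    Cen (1/2) (C (1/2) * A.comp (C (1/2) * X + C (1/2))) (C (1/2) * B.comp (C (1/2) * X + C (1/2))) := by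
  obtain ⟨ε, hε, h⟩ := h
  refine ⟨ε, hε, fun c hc => ?_⟩
  obtain ⟨z, hz, h0, h1⟩ := h c hc
  refine ⟨fun s => z (1/2 * s + 1/2), fun s hs => ?_, by norm_num [h0], by norm_num [h1]⟩
  have hd : HasDerivAt (fun s : ℝ => 1/2 * s + 1/2) (1/2 * 1) s :=
    ((hasDerivAt_id s).const_mul (1/2 : ℝ)).add_const _
  have h2 := hz (1/2 * s + 1/2) ⟨by linarith [hs.1], by linarith [hs.2]⟩
  refine (HasDerivAt.scomp s h2 hd).congr_deriv ?_
  simp only [eval_mul, eval_C, eval_comp, eval_add, eval_X, Complex.real_smul]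
  push_cast
  ring

open Polynomial in
lemma deg3 (P : ℂ[X]) (h : P.natDegree < 4) :
    P = pl [P.coeff 0, P.coeff 1, P.coeff 2, P.coeff 3] := by
  conv_lhs => rw [P.as_sum_range_C_mul_X_pow' h]
  simp only [Finset.sum_range_succ, Finset.sum_range_zero, pl]
  ring

open Polynomial in
lemma deg2 (P : ℂ[X]) (h : P.natDegree < 3) :
    P = pl [P.coeff 0, P.coeff 1, P.coeff 2] := by
  conv_lhs => rw [P.as_sum_range_C_mul_X_pow' h]
  simp only [Finset.sum_range_succ, Finset.sum_range_zero, pl]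
  ring

open Polynomial in
lemma deg_comp (P : ℂ[X]) (n : ℕ) (h : P.degree ≤ n) :
    (C (1/2) * P.comp (C (1/2) * X + C (1/2))).natDegree < n + 1 := by
  have h1 : P.natDegree ≤ n := natDegree_le_iff_degree_le.mpr h
  have h2 := natDegree_C_mul_le (1/2 : ℂ) (P.comp (C (1/2) * X + C (1/2)))
  have h3 : (P.comp (C (1/2) * X + C (1/2))).natDegree ≤ P.natDegree * 1 :=
    natDegree_comp_le.trans (Nat.mul_le_mul_left _ natDegree_linear_le)
  omega

theorem stmt_17 (A B : Polynomial ℂ)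
    (hA : A.degree ≤ 3) (hB : B.degree ≤ 2) :
    ¬ IsCenter 1 (fun t z =>
      z ^ 4 + A.eval (t : ℂ) * z ^ 3 + B.eval (t : ℂ) * z ^ 2) := by
  intro h
  have h := bridge A B h
  rw [deg3 _ (deg_comp A 3 hA), deg2 _ (deg_comp B 2 hB)] at h
  exact gen_case _ _ _ _ _ _ _ h
end

section
/- Let a, b, c, d ∈ ℂ. Then z = 0 is not a center, with period ω = 2π, for the equation ż = z⁴ + (c·cos t + d·sin t)·z³ + (a·cos t + b·sin t)·z². -/
theorem key_lemma (T : ℝ) (hT : 0 < T) (G R W : ℝ → ℂ → ℂ) (L : ℂ) (n : ℕ)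
    (hG : Continuous fun x : ℝ × ℂ => G x.1 x.2) (hR : Continuous fun x : ℝ × ℂ => R x.1 x.2)
    (hW : ∀ z, W T z = W 0 z)
    (hd : ∀ (z : ℝ → ℂ) (t : ℝ), HasDerivAt z (z t ^ 2 * G t (z t)) t →
      HasDerivAt (fun s => W s (z s)) (L * z t ^ n + z t ^ (n + 1) * R t (z t)) t)
    (hc : IsCenter T (fun t z => z ^ 2 * G t z)) : L = 0 := by
  obtain ⟨ε, hε, hc⟩ := hc
  have hK : IsCompact (Set.Icc (0:ℝ) T ×ˢ Metric.closedBall (0:ℂ) 1) :=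
    isCompact_Icc.prod (isCompact_closedBall _ _)
  obtain ⟨K0, hK0⟩ := hK.exists_bound_of_continuousOn hG.continuousOn
  obtain ⟨C0, hC0⟩ := hK.exists_bound_of_continuousOn hR.continuousOn
  obtain ⟨K, hKpos, hK⟩ : ∃ K : ℝ, 0 < K ∧ ∀ t ∈ Set.Icc (0:ℝ) T, ∀ z : ℂ, ‖z‖ ≤ 1 → ‖G t z‖ < K := by
    refine ⟨|K0| + 1, by positivity, fun t ht z hz => ?_⟩
    have := hK0 (t, z) ⟨ht, by simpa using hz⟩
    have h2 := le_abs_self K0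
    simp only at this
    linarith
  obtain ⟨C, hCpos, hC⟩ : ∃ C : ℝ, 0 < C ∧ ∀ t ∈ Set.Icc (0:ℝ) T, ∀ z : ℂ, ‖z‖ ≤ 1 → ‖R t z‖ ≤ C := by
    refine ⟨|C0| + 1, by positivity, fun t ht z hz => ?_⟩
    have := hC0 (t, z) ⟨ht, by simpa using hz⟩
    have h2 := le_abs_self C0
    simp only at this
    linarith
  clear hK0 hC0
  set M := Real.exp (K * T) with hM
  have hMpos : 0 < M := Real.exp_pos _
  -- main estimate
  have main : ∀ r : ℝ, 0 < r → r < ε → r * M ≤ 1 →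
      ‖L‖ ≤ (‖L‖ * (n * K * M ^ (n+1)) * T + M ^ (n+1) * C) * r := by
    intro r hr hrε hrM
    obtain ⟨z, hz, hz0, hzT⟩ := hc (r : ℂ) (by simpa [abs_of_pos hr] using hrε)
    have hz' : ∀ t ∈ Set.Icc (0:ℝ) T, HasDerivAt z (z t ^ 2 * G t (z t)) t := hz
    have hBM : ∀ t ∈ Set.Icc (0:ℝ) T, r * Real.exp (K * t) ≤ r * M := by
      intro t ht
      have : Real.exp (K * t) ≤ M := Real.exp_le_exp.2 (by nlinarith [ht.2])
      nlinarith
    have hb : ∀ t ∈ Set.Icc (0:ℝ) T, ‖z t‖ ≤ r * Real.exp (K * t) := by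
      refine image_norm_le_of_norm_deriv_right_lt_deriv_boundary
        (f' := fun t => z t ^ 2 * G t (z t)) (B' := fun t => r * (Real.exp (K * t) * K))
        (fun t ht => (hz' t ht).continuousAt.continuousWithinAt)
        (fun t ht => (hz' t (Set.Ico_subset_Icc_self ht)).hasDerivWithinAt) ?_ ?_ ?_
      · simp [hz0, abs_of_pos hr]
      · intro t
        have h1 : HasDerivAt (fun t : ℝ => K * t) K t := by
          simpa using (hasDerivAt_id t).const_mul K
        exact (h1.exp).const_mul r
      · intro t ht hzt
        have ht' := Set.Ico_subset_Icc_self ht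
        have h1 : ‖z t‖ ≤ 1 := by rw [hzt]; exact (hBM t ht').trans hrM
        have h2 := hK t ht' _ h1
        have h3 : 0 < ‖z t‖ := by rw [hzt]; positivity
        rw [norm_mul, norm_pow]
        calc ‖z t‖ ^ 2 * ‖G t (z t)‖ ≤ ‖z t‖ * ‖G t (z t)‖ := by
              apply mul_le_mul_of_nonneg_right _ (norm_nonneg _)
              nlinarith
          _ < ‖z t‖ * K := by apply mul_lt_mul_of_pos_left h2 h3
          _ = r * (Real.exp (K * t) * K) := by rw [hzt]; ring
    have hb1 : ∀ t ∈ Set.Icc (0:ℝ) T, ‖z t‖ ≤ M * r := fun t ht => by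
      have := (hb t ht).trans (hBM t ht); linarith
    have hb2 : ∀ t ∈ Set.Icc (0:ℝ) T, ‖z t‖ ≤ 1 := fun t ht => by
      have := (hb1 t ht); linarith
    have hpow : ∀ t ∈ Set.Icc (0:ℝ) T, ‖z t ^ n - (r:ℂ) ^ n‖ ≤ (n * K * M ^ (n+1) * r ^ (n+1)) * T := by
      intro t ht
      have h1 := norm_image_sub_le_of_norm_deriv_le_segment' (f := fun t => z t ^ n)
        (f' := fun t => (n:ℂ) * z t ^ (n-1) * (z t ^ 2 * G t (z t))) (a := 0) (b := T)
        (C := n * K * M ^ (n+1) * r ^ (n+1))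
        (fun t ht => ((hz' t ht).pow n).hasDerivWithinAt) ?_ t ht
      · simp only [hz0, sub_zero] at h1
        refine h1.trans ?_
        apply mul_le_mul_of_nonneg_left ht.2
        positivity
      · intro s hs
        have hs' := Set.Ico_subset_Icc_self hs
        rcases Nat.eq_zero_or_pos n with h0 | h0
        · simp [h0]
        have e1 : ‖(n:ℂ) * z s ^ (n-1) * (z s ^ 2 * G s (z s))‖ = n * ‖z s‖ ^ (n+1) * ‖G s (z s)‖ := by
          obtain ⟨m, rfl⟩ : ∃ m, n = m + 1 := ⟨n - 1, by omega⟩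
          simp only [norm_mul, norm_pow, Complex.norm_natCast, Nat.add_sub_cancel]
          ring
        rw [e1]
        calc (n:ℝ) * ‖z s‖ ^ (n+1) * ‖G s (z s)‖ ≤ n * (M * r) ^ (n+1) * K := by
              gcongr
              · exact hb1 s hs'
              · exact (hK s hs' _ (hb2 s hs')).le
          _ = _ := by rw [mul_pow]; ring
    have hTT : T ∈ Set.Icc (0:ℝ) T := ⟨hT.le, le_rfl⟩
    have h1 := norm_image_sub_le_of_norm_deriv_le_segment'
        (f := fun t => W t (z t) - (t:ℂ) * (L * (r:ℂ) ^ n))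
        (f' := fun t => (L * z t ^ n + z t ^ (n + 1) * R t (z t)) - 1 * (L * (r:ℂ) ^ n)) (a := 0) (b := T)
        (C := (‖L‖ * (n * K * M ^ (n+1)) * T + M ^ (n+1) * C) * r ^ (n+1))
        (fun t ht => ((hd z t (hz' t ht)).sub
          ((Complex.ofRealCLM.hasDerivAt (x := t)).mul_const _)).hasDerivWithinAt) ?_ T hTT
    · simp only [hz0, hzT, hW, sub_zero, Complex.ofReal_zero, zero_mul] at h1
      rw [sub_sub_cancel_left, norm_neg, norm_mul, norm_mul, norm_pow, Complex.norm_real,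
        Complex.norm_real, Real.norm_of_nonneg hr.le, Real.norm_of_nonneg hT.le] at h1
      have hp : 0 < T * r ^ n := by positivity
      refine le_of_mul_le_mul_left ?_ hp
      calc _ = T * (‖L‖ * r ^ n) := by ring
        _ ≤ _ := h1
        _ = _ := by ring
    · intro s hs
      have hs' := Set.Ico_subset_Icc_self hs
      have e1 : (L * z s ^ n + z s ^ (n + 1) * R s (z s)) - 1 * (L * (r:ℂ) ^ n)
        = L * (z s ^ n - (r:ℂ)^n) + z s ^ (n + 1) * R s (z s) := by ring
      rw [e1]
      refine (norm_add_le _ _).trans ?_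
      rw [norm_mul, norm_mul, norm_pow]
      calc _ ≤ ‖L‖ * ((n * K * M ^ (n+1) * r ^ (n+1)) * T) + (M * r) ^ (n+1) * C := by
            gcongr
            · exact hpow s hs'
            · exact hb1 s hs'
            · exact hC s hs' _ (hb2 s hs')
        _ = _ := by rw [mul_pow]; ring
  set D := ‖L‖ * (n * K * M ^ (n+1)) * T + M ^ (n+1) * C with hD
  have hDpos : 0 < D := by positivity
  by_contra hL
  have hLpos : 0 < ‖L‖ := norm_pos_iff.2 hL
  have hmin : 0 < min (ε/2) (min (1/M) (‖L‖ / (2 * D))) := by positivity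
  have h1 := main _ hmin ?_ ?_
  · have h2 : min (ε/2) (min (1/M) (‖L‖ / (2 * D))) ≤ ‖L‖ / (2 * D) :=
      (min_le_right _ _).trans (min_le_right _ _)
    have h3 : D * (‖L‖ / (2 * D)) = ‖L‖ / 2 := by field_simp
    have h4 := mul_le_mul_of_nonneg_left h2 hDpos.le
    linarith
  · have := min_le_left (ε/2) (min (1/M) (‖L‖ / (2 * D)))
    linarith
  · have h2 : min (ε/2) (min (1/M) (‖L‖ / (2 * D))) ≤ 1 / M :=
      (min_le_right _ _).trans (min_le_left _ _)
    rwa [le_div_iff₀ hMpos] at h2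

noncomputable def ee (t : ℝ) : ℂ := Complex.exp (Complex.I * t)
noncomputable def ff (t : ℝ) : ℂ := Complex.exp (-(Complex.I * t))

theorem hasDerivAt_arg (t : ℝ) : HasDerivAt (fun t : ℝ => Complex.I * (t:ℂ)) Complex.I t := by
  simpa using (Complex.ofRealCLM.hasDerivAt (x := t)).const_mul Complex.I

theorem ee_deriv (c : ℂ) (k : ℕ) (t : ℝ) :
    HasDerivAt (fun t => c * ee t ^ k) (c * (Complex.I * k * ee t ^ k)) t := by
  have h : HasDerivAt ee (ee t * Complex.I) t := (hasDerivAt_arg t).cexp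
  refine ((h.pow k).const_mul c).congr_deriv ?_
  rcases k with _ | k
  · simp
  · simp only [Nat.add_sub_cancel]; ring

theorem ff_deriv (c : ℂ) (k : ℕ) (t : ℝ) :
    HasDerivAt (fun t => c * ff t ^ k) (c * (-Complex.I * k * ff t ^ k)) t := by
  have h : HasDerivAt ff (ff t * -Complex.I) t := (hasDerivAt_arg t).neg.cexp
  refine ((h.pow k).const_mul c).congr_deriv ?_
  rcases k with _ | k
  · simp
  · simp only [Nat.add_sub_cancel]; ring

theorem ee_ff (t : ℝ) : ee t * ff t = 1 := by
  rw [ee, ff, ← Complex.exp_add]; simp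

theorem ee_cont : Continuous ee := by unfold ee; fun_prop
theorem ff_cont : Continuous ff := by unfold ff; fun_prop
theorem ee_per : ee (2 * Real.pi) = ee 0 := by
  simp only [ee]; push_cast
  rw [show Complex.I * (2 * (Real.pi:ℂ)) = 2 * Real.pi * Complex.I by ring, Complex.exp_two_pi_mul_I]; simp
theorem ff_per : ff (2 * Real.pi) = ff 0 := by
  simp only [ff]; push_cast
  rw [show Complex.I * (2 * (Real.pi:ℂ)) = 2 * Real.pi * Complex.I by ring, Complex.exp_neg,
    Complex.exp_two_pi_mul_I]; simp

theorem cos_ee (t : ℝ) : ((Real.cos t : ℝ) : ℂ) = (ee t + ff t) / 2 := by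
  rw [Complex.ofReal_cos, Complex.cos, ee, ff]; ring_nf
theorem sin_ee (t : ℝ) : ((Real.sin t : ℝ) : ℂ) = (ff t - ee t) * Complex.I / 2 := by
  rw [Complex.ofReal_sin, Complex.sin, ee, ff]; ring_nf

noncomputable def pv2 (a b p q g e f : ℂ) : ℂ :=
    ((1)*a) * e^1 +
    ((-1)*b) * f^1

theorem pv2_deriv (a b p q g : ℂ) (t : ℝ) : HasDerivAt (fun t => pv2 a b p q g (ee t) (ff t))
    ((fun e f => Complex.I * (1 * 1 * (a*e+b*f) + 0 * 0 * (p*e+q*f) + 0 * 0 * g - 0)) (ee t) (ff t)) t := by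
  refine HasDerivAt.congr_deriv (f := fun t => pv2 a b p q g (ee t) (ff t)) ((ee_deriv _ 1 t).add (ff_deriv _ 1 t)) ?_
  have h := ee_ff t
  have he : ee t ≠ 0 := left_ne_zero_of_mul_eq_one h
  have hf : ff t = (ee t)⁻¹ := eq_inv_of_mul_eq_one_right h
  simp only []
  generalize ee t = e at *
  rw [hf]
  push_cast
  field_simp
  ring

noncomputable def pv3 (a b p q g e f : ℂ) : ℂ :=
    ((1)*a^2) * e^2 +
    ((1)*b^2) * f^2 +
    ((1)*p) * e^1 +
    ((-1)*q) * f^1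

theorem pv3_deriv (a b p q g : ℂ) (t : ℝ) : HasDerivAt (fun t => pv3 a b p q g (ee t) (ff t))
    ((fun e f => Complex.I * (2 * pv2 a b p q g e f * (a*e+b*f) + 1 * 1 * (p*e+q*f) + 0 * 0 * g - 0)) (ee t) (ff t)) t := by
  refine HasDerivAt.congr_deriv (f := fun t => pv3 a b p q g (ee t) (ff t)) ((((ee_deriv _ 2 t).add (ff_deriv _ 2 t)).add (ee_deriv _ 1 t)).add (ff_deriv _ 1 t)) ?_
  have h := ee_ff t
  have he : ee t ≠ 0 := left_ne_zero_of_mul_eq_one h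
  have hf : ff t = (ee t)⁻¹ := eq_inv_of_mul_eq_one_right h
  simp only [pv2]
  generalize ee t = e at *
  rw [hf]
  push_cast
  field_simp
  ring

noncomputable def pv4 (a b p q g e f : ℂ) : ℂ :=
    ((1)*a^3) * e^3 +
    ((3)*a^2*b) * e^1 +
    ((-3)*a*b^2) * f^1 +
    ((-1)*b^3) * f^3 +
    ((5/2)*a*p) * e^2 +
    ((5/2)*b*q) * f^2

theorem pv4_deriv (a b p q g : ℂ) (t : ℝ) : HasDerivAt (fun t => pv4 a b p q g (ee t) (ff t))
    ((fun e f => Complex.I * (3 * pv3 a b p q g e f * (a*e+b*f) + 2 * pv2 a b p q g e f * (p*e+q*f) + 1 * 1 * g - (b*p - a*q + g))) (ee t) (ff t)) t := by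
  refine HasDerivAt.congr_deriv (f := fun t => pv4 a b p q g (ee t) (ff t)) ((((((ee_deriv _ 3 t).add (ee_deriv _ 1 t)).add (ff_deriv _ 1 t)).add (ff_deriv _ 3 t)).add (ee_deriv _ 2 t)).add (ff_deriv _ 2 t)) ?_
  have h := ee_ff t
  have he : ee t ≠ 0 := left_ne_zero_of_mul_eq_one h
  have hf : ff t = (ee t)⁻¹ := eq_inv_of_mul_eq_one_right h
  simp only [pv2, pv3]
  generalize ee t = e at *
  rw [hf]
  push_cast
  field_simp
  ring

noncomputable def pv5 (a b p q g e f : ℂ) : ℂ :=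
    ((1)*a^4) * e^4 +
    ((8)*a^3*b + (3/2)*p^2) * e^2 +
    ((8)*a*b^3 + (3/2)*q^2) * f^2 +
    ((1)*b^4) * f^4 +
    ((13/3)*a^2*p) * e^3 +
    ((10)*a*b*p + (3)*a^2*q + (2)*a*g) * e^1 +
    ((-10)*a*b*q + (-3)*b^2*p + (2)*b*g) * f^1 +
    ((-13/3)*b^2*q) * f^3

theorem pv5_deriv (a b p q g : ℂ) (t : ℝ) : HasDerivAt (fun t => pv5 a b p q g (ee t) (ff t))
    ((fun e f => Complex.I * (4 * pv4 a b p q g e f * (a*e+b*f) + 3 * pv3 a b p q g e f * (p*e+q*f) + 2 * pv2 a b p q g e f * g - 0)) (ee t) (ff t)) t := by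
  refine HasDerivAt.congr_deriv (f := fun t => pv5 a b p q g (ee t) (ff t)) ((((((((ee_deriv _ 4 t).add (ee_deriv _ 2 t)).add (ff_deriv _ 2 t)).add (ff_deriv _ 4 t)).add (ee_deriv _ 3 t)).add (ee_deriv _ 1 t)).add (ff_deriv _ 1 t)).add (ff_deriv _ 3 t)) ?_
  have h := ee_ff t
  have he : ee t ≠ 0 := left_ne_zero_of_mul_eq_one h
  have hf : ff t = (ee t)⁻¹ := eq_inv_of_mul_eq_one_right h
  simp only [pv2, pv3, pv4]
  generalize ee t = e at *
  rw [hf]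
  push_cast
  field_simp
  ring

noncomputable def pv6 (a b p q g e f : ℂ) : ℂ :=
    ((1)*a^5) * e^5 +
    ((15)*a^4*b + (35/6)*a*p^2) * e^3 +
    ((40)*a^3*b^2 + (15/2)*b*p^2 + (10)*a*p*q + (3)*p*g) * e^1 +
    ((-40)*a^2*b^3 + (-15/2)*a*q^2 + (-10)*b*p*q + (3)*q*g) * f^1 +
    ((-15)*a*b^4 + (-35/6)*b*q^2) * f^3 +
    ((-1)*b^5) * f^5 +
    ((77/12)*a^3*p) * e^4 +
    ((251/6)*a^2*b*p + (19/2)*a^3*q + (13/2)*a^2*g) * e^2 +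
    ((251/6)*a*b^2*q + (19/2)*b^3*p + (-13/2)*b^2*g) * f^2 +
    ((77/12)*b^3*q) * f^4

theorem pv6_deriv (a b p q g : ℂ) (t : ℝ) : HasDerivAt (fun t => pv6 a b p q g (ee t) (ff t))
    ((fun e f => Complex.I * (5 * pv5 a b p q g e f * (a*e+b*f) + 4 * pv4 a b p q g e f * (p*e+q*f) + 3 * pv3 a b p q g e f * g - (23*a*b^2*p - 23*a^2*b*q + 20*a*b*g))) (ee t) (ff t)) t := by
  refine HasDerivAt.congr_deriv (f := fun t => pv6 a b p q g (ee t) (ff t)) ((((((((((ee_deriv _ 5 t).add (ee_deriv _ 3 t)).add (ee_deriv _ 1 t)).add (ff_deriv _ 1 t)).add (ff_deriv _ 3 t)).add (ff_deriv _ 5 t)).add (ee_deriv _ 4 t)).add (ee_deriv _ 2 t)).add (ff_deriv _ 2 t)).add (ff_deriv _ 4 t)) ?_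
  have h := ee_ff t
  have he : ee t ≠ 0 := left_ne_zero_of_mul_eq_one h
  have hf : ff t = (ee t)⁻¹ := eq_inv_of_mul_eq_one_right h
  simp only [pv3, pv4, pv5]
  generalize ee t = e at *
  rw [hf]
  push_cast
  field_simp
  ring

noncomputable def pv7 (a b p q g e f : ℂ) : ℂ :=
    ((1)*a^6) * e^6 +
    ((24)*a^5*b + (85/6)*a^2*p^2) * e^4 +
    ((165)*a^4*b^2 + (65)*a*b*p^2 + (145/3)*a^2*p*q + (19)*a*p*g) * e^2 +
    ((165)*a^2*b^4 + (65)*a*b*q^2 + (145/3)*b^2*p*q + (-19)*b*q*g) * f^2 +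
    ((24)*a*b^5 + (85/6)*b^2*q^2) * f^4 +
    ((1)*b^6) * f^6 +
    ((87/10)*a^4*p) * e^5 +
    ((659/6)*a^3*b*p + (62/3)*a^4*q + (43/3)*a^3*g + (5/2)*p^3) * e^3 +
    ((251)*a^2*b^2*p + (97)*a^3*b*q + (51)*a^2*b*g + (15/2)*p^2*q) * e^1 +
    ((-251)*a^2*b^2*q + (-97)*a*b^3*p + (51)*a*b^2*g + (-15/2)*p*q^2) * f^1 +
    ((-659/6)*a*b^3*q + (-62/3)*b^4*p + (43/3)*b^3*g + (-5/2)*q^3) * f^3 +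
    ((-87/10)*b^4*q) * f^5

theorem pv7_deriv (a b p q g : ℂ) (t : ℝ) : HasDerivAt (fun t => pv7 a b p q g (ee t) (ff t))
    ((fun e f => Complex.I * (6 * pv6 a b p q g e f * (a*e+b*f) + 5 * pv5 a b p q g e f * (p*e+q*f) + 4 * pv4 a b p q g e f * g - (30*b^2*p^2 + 28*b*p*g - 30*a^2*q^2 + 28*a*q*g))) (ee t) (ff t)) t := by
  refine HasDerivAt.congr_deriv (f := fun t => pv7 a b p q g (ee t) (ff t)) ((((((((((((ee_deriv _ 6 t).add (ee_deriv _ 4 t)).add (ee_deriv _ 2 t)).add (ff_deriv _ 2 t)).add (ff_deriv _ 4 t)).add (ff_deriv _ 6 t)).add (ee_deriv _ 5 t)).add (ee_deriv _ 3 t)).add (ee_deriv _ 1 t)).add (ff_deriv _ 1 t)).add (ff_deriv _ 3 t)).add (ff_deriv _ 5 t)) ?_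
  have h := ee_ff t
  have he : ee t ≠ 0 := left_ne_zero_of_mul_eq_one h
  have hf : ff t = (ee t)⁻¹ := eq_inv_of_mul_eq_one_right h
  simp only [pv4, pv5, pv6]
  generalize ee t = e at *
  rw [hf]
  push_cast
  field_simp
  ring

theorem pv_algebra (a b p q g : ℂ) (hg : g ≠ 0) (h4 : b*p - a*q + g = 0)
    (h6 : 23*a*b^2*p - 23*a^2*b*q + 20*a*b*g = 0)
    (h7 : 30*b^2*p^2 + 28*b*p*g - 30*a^2*q^2 + 28*a*q*g = 0) : False := by
  have h1 : g * (a * b) = 0 := by linear_combination (23*a*b*h4 - h6)/3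
  have h2 : g * (b*p + a*q) = 0 := by linear_combination (30*(b*p+a*q)*h4 - h7)/2
  have h3 : a * b = 0 := (mul_eq_zero.1 h1).resolve_left hg
  have h5 : b*p + a*q = 0 := (mul_eq_zero.1 h2).resolve_left hg
  rcases mul_eq_zero.1 h3 with h | h
  · apply hg; subst h; linear_combination h4 - h5
  · apply hg; subst h; linear_combination h4 + h5

noncomputable def WW (a b p q g : ℂ) (t : ℝ) (z : ℂ) : ℂ :=
  z + pv2 a b p q g (ee t) (ff t) * z^2 + pv3 a b p q g (ee t) (ff t) * z^3
    + pv4 a b p q g (ee t) (ff t) * z^4 + pv5 a b p q g (ee t) (ff t) * z^5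
    + pv6 a b p q g (ee t) (ff t) * z^6 + pv7 a b p q g (ee t) (ff t) * z^7

noncomputable def GG (a b p q g : ℂ) (t : ℝ) (z : ℂ) : ℂ :=
  -Complex.I * (g * z^2 + (p * ee t + q * ff t) * z + (a * ee t + b * ff t))

noncomputable def RR (a b p q g : ℂ) (t : ℝ) (z : ℂ) : ℂ :=
  -Complex.I * ((7 * pv7 a b p q g (ee t) (ff t) * (a * ee t + b * ff t)
    + 6 * pv6 a b p q g (ee t) (ff t) * (p * ee t + q * ff t) + 5 * pv5 a b p q g (ee t) (ff t) * g)
    + z * (7 * pv7 a b p q g (ee t) (ff t) * (p * ee t + q * ff t) + 6 * pv6 a b p q g (ee t) (ff t) * g)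
    + z^2 * (7 * pv7 a b p q g (ee t) (ff t) * g))

theorem WW_deriv (a b p q g : ℂ) (z : ℝ → ℂ) (t : ℝ)
    (hz : HasDerivAt z (z t ^ 2 * GG a b p q g t (z t)) t) :
    HasDerivAt (fun s => WW a b p q g s (z s))
      (-Complex.I * (b*p - a*q + g) * z t ^ 4
        + -Complex.I * (23*a*b^2*p - 23*a^2*b*q + 20*a*b*g) * z t ^ 6
        + -Complex.I * (30*b^2*p^2 + 28*b*p*g - 30*a^2*q^2 + 28*a*q*g) * z t ^ 7
        + z t ^ 8 * RR a b p q g t (z t)) t := by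
  refine HasDerivAt.congr_deriv (f := fun s => WW a b p q g s (z s))
    ((((((hz.add ((pv2_deriv a b p q g t).mul (hz.pow 2))).add
      ((pv3_deriv a b p q g t).mul (hz.pow 3))).add
      ((pv4_deriv a b p q g t).mul (hz.pow 4))).add
      ((pv5_deriv a b p q g t).mul (hz.pow 5))).add
      ((pv6_deriv a b p q g t).mul (hz.pow 6))).add
      ((pv7_deriv a b p q g t).mul (hz.pow 7))) ?_
  simp only [GG, RR, Pi.pow_apply]
  generalize pv2 a b p q g (ee t) (ff t) = v2
  generalize pv3 a b p q g (ee t) (ff t) = v3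
  generalize pv4 a b p q g (ee t) (ff t) = v4
  generalize pv5 a b p q g (ee t) (ff t) = v5
  generalize pv6 a b p q g (ee t) (ff t) = v6
  generalize pv7 a b p q g (ee t) (ff t) = v7
  push_cast
  ring

theorem GG_cont (a b p q g : ℂ) : Continuous fun x : ℝ × ℂ => GG a b p q g x.1 x.2 := by
  have h1 := ee_cont
  have h2 := ff_cont
  unfold GG
  fun_prop

theorem RR_cont (a b p q g : ℂ) : Continuous fun x : ℝ × ℂ => RR a b p q g x.1 x.2 := by
  have h1 := ee_cont
  have h2 := ff_cont
  unfold RR pv5 pv6 pv7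
  fun_prop

theorem not_center_aux (a b p q g : ℂ) (hg : g ≠ 0) :
    ¬ IsCenter (2 * Real.pi) (fun t z => z ^ 2 * GG a b p q g t z) := by
  intro hc
  have hT : 0 < 2 * Real.pi := by positivity
  have hG := GG_cont a b p q g
  have hR := RR_cont a b p q g
  have hW : ∀ z, WW a b p q g (2 * Real.pi) z = WW a b p q g 0 z := by
    intro z; simp only [WW, ee_per, ff_per]
  have hI : -Complex.I ≠ 0 := neg_ne_zero.2 Complex.I_ne_zero
  have h4 : b*p - a*q + g = 0 := by
    refine (mul_eq_zero.1 (key_lemma _ hT (GG a b p q g)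
      (fun t z => -Complex.I * (23*a*b^2*p - 23*a^2*b*q + 20*a*b*g) * z
        + -Complex.I * (30*b^2*p^2 + 28*b*p*g - 30*a^2*q^2 + 28*a*q*g) * z ^ 2
        + z ^ 3 * RR a b p q g t z) (WW a b p q g) (-Complex.I * (b*p - a*q + g)) 4
        hG (by fun_prop) hW (fun z t hz => (WW_deriv a b p q g z t hz).congr_deriv ?_) hc)).resolve_left hI
    ring
  have h6 : 23*a*b^2*p - 23*a^2*b*q + 20*a*b*g = 0 := by
    refine (mul_eq_zero.1 (key_lemma _ hT (GG a b p q g)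
      (fun t z => -Complex.I * (30*b^2*p^2 + 28*b*p*g - 30*a^2*q^2 + 28*a*q*g)
        + z * RR a b p q g t z) (WW a b p q g)
        (-Complex.I * (23*a*b^2*p - 23*a^2*b*q + 20*a*b*g)) 6
        hG (by fun_prop) hW (fun z t hz => (WW_deriv a b p q g z t hz).congr_deriv ?_) hc)).resolve_left hI
    rw [h4]; ring
  have h7 : 30*b^2*p^2 + 28*b*p*g - 30*a^2*q^2 + 28*a*q*g = 0 := by
    refine (mul_eq_zero.1 (key_lemma _ hT (GG a b p q g)
      (RR a b p q g) (WW a b p q g)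
        (-Complex.I * (30*b^2*p^2 + 28*b*p*g - 30*a^2*q^2 + 28*a*q*g)) 7
        hG hR hW (fun z t hz => (WW_deriv a b p q g z t hz).congr_deriv ?_) hc)).resolve_left hI
    rw [h4, h6]; ring
  exact pv_algebra a b p q g hg h4 h6 h7

theorem stmt_18 (a b c d : ℂ) :
    ¬ IsCenter (2 * Real.pi) (fun t z =>
      z ^ 4 + (c * (Real.cos t : ℂ) + d * (Real.sin t : ℂ)) * z ^ 3 +
        (a * (Real.cos t : ℂ) + b * (Real.sin t : ℂ)) * z ^ 2) := by
  have h := not_center_aux (Complex.I * (a - Complex.I * b) / 2) (Complex.I * (a + Complex.I * b) / 2)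
    (Complex.I * (c - Complex.I * d) / 2) (Complex.I * (c + Complex.I * d) / 2) Complex.I Complex.I_ne_zero
  refine fun hc => h (Eq.mp (congrArg (IsCenter (2 * Real.pi)) ?_) hc)
  funext t z
  simp only [cos_ee, sin_ee, GG]
  have hI := Complex.I_sq
  generalize Complex.I = i at *
  generalize ee t = e
  generalize ff t = f
  linear_combination (z^4 + (c*(e+f)/2 + d * (f - e)*i/2) * z^3 + (a*(e+f)/2 + b * (f - e)*i/2) * z^2) * hI
end
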